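/- arXiv:0904.4814 — 5 statements merged into one kernel-verified Lean document; each statement's English description precedes it below -/
import Mathlib

section
/- Every board S admits at least four good diagonals. -/
open scoped Matrix

/-- A cell of the integer grid, representing the closed unit square
`[p₁, p₁+1] × [p₂, p₂+1] ⊆ ℝ²`. -/
abbrev Cell : Type := ℤ × ℤ

/-- The closed unit square in `ℝ²` corresponding to a cell. -/
def unitSquare (p : Cell) : Set (ℝ × ℝ) :=
  (Set.Icc (p.1 : ℝ) ((p.1 : ℝ) + 1)) ×ˢ (Set.Icc (p.2 : ℝ) ((p.2 : ℝ) + 1))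

/-- The region of the plane covered by a finite set of cells. -/
def Region (S : Finset Cell) : Set (ℝ × ℝ) := ⋃ p ∈ S, unitSquare p

/-- A board: a finite nonempty set of cells whose region is homeomorphic to the
closed unit disk in `ℝ²`. -/
def IsBoard (S : Finset Cell) : Prop :=
  S.Nonempty ∧
    Nonempty ((Region S) ≃ₜ (Metric.closedBall (0 : EuclideanSpace ℝ (Fin 2)) 1))

/-- A cell is black if the sum of its coordinates is even. -/
def IsBlackCell (p : Cell) : Prop := Even (p.1 + p.2)

instance (p : Cell) : Decidable (IsBlackCell p) := by
  unfold IsBlackCell; infer_instance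

/-- The black cells of `S`. -/
def blackCells (S : Finset Cell) : Finset Cell := S.filter IsBlackCell

/-- The white cells of `S`. -/
def whiteCells (S : Finset Cell) : Finset Cell := S.filter fun p => ¬ IsBlackCell p

/-- Two cells are adjacent when they share an edge. -/
def Adjacent (p q : Cell) : Prop :=
  p - q = (1, 0) ∨ p - q = (-1, 0) ∨ p - q = (0, 1) ∨ p - q = (0, -1)

instance (p q : Cell) : Decidable (Adjacent p q) := by
  unfold Adjacent; infer_instance

/-- The black-to-white adjacency matrix of a set of cells, with respect to
labelings `β` of the black cells and `ω` of the white cells. -/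
def btwMatrix {S : Finset Cell} {b w : ℕ}
    (β : Fin b ≃ blackCells S) (ω : Fin w ≃ whiteCells S) :
    Matrix (Fin b) (Fin w) ℤ :=
  fun i j => if Adjacent (β i : Cell) (ω j : Cell) then 1 else 0

/-- The four vertices of a cell. -/
def cellVerts (p : Cell) : Finset Cell := {p, p + (1, 0), p + (0, 1), p + (1, 1)}

/-- `v` is a vertex of `S` if it is a vertex of some cell of `S`. -/
def IsVertex (S : Finset Cell) (v : Cell) : Prop := ∃ p ∈ S, v ∈ cellVerts p

/-- The cells of `S` incident to the vertex `v`. -/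
def incidentCells (S : Finset Cell) (v : Cell) : Finset Cell :=
  S.filter fun p => v ∈ cellVerts p

/-- The point of `ℝ²` corresponding to a grid point. -/
def toR (v : Cell) : ℝ × ℝ := ((v.1 : ℝ), (v.2 : ℝ))

/-- A boundary vertex of `S`: a vertex lying in the topological frontier of the
region of `S`. -/
def IsBoundaryVertex (S : Finset Cell) (v : Cell) : Prop :=
  IsVertex S v ∧ toR v ∈ frontier (Region S)

/-- An interior vertex of `S`: a vertex not lying in the frontier of the region
of `S`. -/
def IsInteriorVertex (S : Finset Cell) (v : Cell) : Prop :=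
  IsVertex S v ∧ toR v ∉ frontier (Region S)

/-- A corner of `S`: a vertex incident to exactly one cell of `S`. -/
def IsBoardCorner (S : Finset Cell) (v : Cell) : Prop := (incidentCells S v).card = 1

/-- `a` and `b` are opposite vertices of the cell `q`. -/
def OppositeVerts (q a b : Cell) : Prop :=
  ({a, b} : Finset Cell) = {q, q + (1, 1)} ∨
    ({a, b} : Finset Cell) = {q + (1, 0), q + (0, 1)}

/-- A pre-diagonal of `S` of length `k`: vertices `v 0, …, v k` and cells
`s 0, …, s (k-1)` as in the definition of a diagonal.  (The values of `v` at
indices `> k` and of `s` at indices `≥ k` are irrelevant.) -/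
def IsPreDiagonal (S : Finset Cell) (k : ℕ) (v : ℕ → Cell) (s : ℕ → Cell) : Prop :=
  1 ≤ k ∧
  IsBoardCorner S (v 0) ∧
  (∀ i, 0 < i → i < k → IsInteriorVertex S (v i)) ∧
  (∀ i, i < k → s i ∈ S) ∧
  (∀ i, i < k → OppositeVerts (s i) (v i) (v (i + 1))) ∧
  (∀ i, i + 1 < k → (cellVerts (s i) ∩ cellVerts (s (i + 1))).card = 1) ∧
  (∀ i j, i ≤ k → j ≤ k → i ≠ j → v i ≠ v j) ∧
  (∀ i j, i < k → j < k → i ≠ j → s i ≠ s j)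

/-- The pre-diagonal `(k', v', s')` extends the pre-diagonal `(k, v, s)`. -/
def PreDiagExtends (k' : ℕ) (v' s' : ℕ → Cell) (k : ℕ) (v s : ℕ → Cell) : Prop :=
  k ≤ k' ∧ (∀ i ≤ k, v' i = v i) ∧ (∀ i < k, s' i = s i)

/-- A diagonal: a pre-diagonal that is maximal under extension. -/
def IsDiagonal (S : Finset Cell) (k : ℕ) (v s : ℕ → Cell) : Prop :=
  IsPreDiagonal S k v s ∧
    ∀ k' v' s', IsPreDiagonal S k' v' s' → PreDiagExtends k' v' s' k v s → k' = k

/-- A good diagonal: at least one of the two unit edges of the last cell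
`s (k-1)` containing the final vertex `v k` is contained in the frontier of the
region of `S`. -/
def IsGoodDiagonal (S : Finset Cell) (k : ℕ) (v s : ℕ → Cell) : Prop :=
  IsDiagonal S k v s ∧
    ∃ a ∈ cellVerts (s (k - 1)),
      (a - v k = (1, 0) ∨ a - v k = (0, 1) ∨ a - v k = (-1, 0) ∨ a - v k = (0, -1)) ∧
      segment ℝ (toR (v k)) (toR a) ⊆ frontier (Region S)

/-! ### Topological part -/

theorem exists_real_lift {A : Type*} [TopologicalSpace A] [ContractibleSpace A]
    (f : C(A, AddCircle (1 : ℝ))) : ∃ g : C(A, ℝ), ∀ a, ((g a : ℝ) : AddCircle (1 : ℝ)) = f a := by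
  have cov := AddCircle.isCoveringMap_coe (1 : ℝ)
  obtain ⟨y, ⟨H⟩⟩ := (id_nullhomotopic A)
  let K : C(unitInterval × A, AddCircle (1 : ℝ)) := f.comp H.symm.toContinuousMap
  obtain ⟨r, hr⟩ := QuotientAddGroup.mk_surjective (f y)
  have h0 : ∀ a, K (0, a) = ((((ContinuousMap.const A r) a : ℝ)) : AddCircle (1 : ℝ)) := by
    intro a
    have : H.symm (0, a) = y := by rw [ContinuousMap.Homotopy.apply_zero]; rfl
    change f (H.symm (0, a)) = _
    rw [this, ← hr]; rfl
  refine ⟨(cov.liftHomotopy K (ContinuousMap.const A r) h0).comp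
    ((ContinuousMap.const A 1).prodMk (ContinuousMap.id A)), fun a => ?_⟩
  have h1 := congr_fun (cov.liftHomotopy_lifts K (ContinuousMap.const A r) h0) (1, a)
  have h2 : K (1, a) = f a := by
    change f (H.symm (1, a)) = _
    rw [ContinuousMap.Homotopy.apply_one]; rfl
  rw [← h2, ← h1]; rfl

theorem contractible_region {S : Finset Cell} (hS : IsBoard S) :
    ContractibleSpace (Region S) := by
  obtain ⟨_, ⟨e⟩⟩ := hS
  have : ContractibleSpace (Metric.closedBall (0 : EuclideanSpace ℝ (Fin 2)) 1) :=
    (convex_closedBall _ _).contractibleSpace ⟨0, by simp⟩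
  exact e.contractibleSpace

/-- Bilinear interpolation of a local potential on the cell `p`. -/
noncomputable def bil (h w : Cell → ℤ) (p : Cell) (x : ℝ × ℝ) : ℝ :=
  (x.1 - p.1) * (1 - (x.2 - p.2)) * h p + (1 - (x.1 - p.1)) * (x.2 - p.2) * w p
    + (x.1 - p.1) * (x.2 - p.2) * (h p + w (p + (1, 0)))

theorem coe_eq_of_int {a b : ℝ} (n : ℤ) (h : a - b = n) :
    (a : AddCircle (1 : ℝ)) = (b : AddCircle (1 : ℝ)) := by
  rw [eq_comm, QuotientAddGroup.eq]
  refine ⟨n, ?_⟩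
  simp; linarith

theorem int_of_coe_eq {a b : ℝ} 
    (h : (a : AddCircle (1 : ℝ)) = (b : AddCircle (1 : ℝ))) : ∃ n : ℤ, a - b = n := by
  rw [eq_comm, QuotientAddGroup.eq] at h
  obtain ⟨n, hn⟩ := h
  refine ⟨n, ?_⟩
  simp at hn; linarith

theorem bil_floor (h w : Cell → ℤ) (p : Cell)
    (hc : h p + w (p + (1, 0)) = w p + h (p + (0, 1))) (x : ℝ × ℝ) (hx : x ∈ unitSquare p) :
    (bil h w (⌊x.1⌋, ⌊x.2⌋) x : AddCircle (1 : ℝ)) = (bil h w p x : AddCircle (1 : ℝ)) := by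
  obtain ⟨⟨h1, h2⟩, h3, h4⟩ := hx
  obtain ⟨a, b⟩ := p
  obtain ⟨x, y⟩ := x
  have hc' : (h (a, b) : ℝ) + w (a + 1, b) = w (a, b) + h (a, b + 1) := by
    have := hc
    simp only [Prod.mk_add_mk, add_zero] at this
    exact_mod_cast this
  simp only at h1 h2 h3 h4 ⊢
  rcases h2.lt_or_eq with h2 | h2 <;> rcases h4.lt_or_eq with h4 | h4
  · rw [Int.floor_eq_iff.2 ⟨h1, h2⟩, Int.floor_eq_iff.2 ⟨h3, h4⟩]
  · have hf : ⌊y⌋ = b + 1 := by rw [h4]; simp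
    rw [Int.floor_eq_iff.2 ⟨h1, h2⟩, hf]
    apply coe_eq_of_int (-w (a, b))
    simp only [bil, Prod.mk_add_mk, add_zero, h4]
    push_cast
    linear_combination (a - x) * hc'
  · have hf : ⌊x⌋ = a + 1 := by rw [h2]; simp
    rw [Int.floor_eq_iff.2 ⟨h3, h4⟩, hf]
    apply coe_eq_of_int (-h (a, b))
    simp only [bil, Prod.mk_add_mk, add_zero, h2]
    push_cast
    ring
  · have hf : ⌊y⌋ = b + 1 := by rw [h4]; simp
    have hf' : ⌊x⌋ = a + 1 := by rw [h2]; simp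
    rw [hf', hf]
    apply coe_eq_of_int (-h (a, b) - w (a + 1, b))
    simp only [bil, Prod.mk_add_mk, add_zero, h2, h4]
    push_cast
    ring

theorem unitSquare_closed (p : Cell) : IsClosed (unitSquare p) := isClosed_Icc.prod isClosed_Icc

theorem unitSquare_subset {S : Finset Cell} {p : Cell} (hp : p ∈ S) : unitSquare p ⊆ Region S :=
  Set.subset_biUnion_of_mem (u := unitSquare) (by exact hp)

theorem region_closed (S : Finset Cell) : IsClosed (Region S) :=
  S.finite_toSet.isClosed_biUnion fun p _ => unitSquare_closed p

theorem continuousOn_region {S : Finset Cell} {f : ℝ × ℝ → AddCircle (1 : ℝ)}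
    (hf : ∀ p ∈ S, ContinuousOn f (unitSquare p)) : ContinuousOn f (Region S) := by
  have : Region S = ⋃ p : S, unitSquare p := by
    ext x; simp [Region]
  rw [this]
  exact (locallyFinite_of_finite _).continuousOn_iUnion (fun p => unitSquare_closed p)
    (fun p => hf p p.2)

theorem bil_continuous (h w : Cell → ℤ) (p : Cell) : Continuous (bil h w p) := by
  unfold bil; fun_prop

/-- Every closed integral cellular 1-cochain on a board is exact. -/
theorem exact_of_closed {S : Finset Cell} (hS : IsBoard S) (h w : Cell → ℤ)
    (hc : ∀ p ∈ S, h p + w (p + (1, 0)) = w p + h (p + (0, 1))) :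
    ∃ u : Cell → ℤ, ∀ p ∈ S, u (p + (1, 0)) - u p = h p ∧ u (p + (0, 1)) - u p = w p ∧
      u (p + (1, 1)) - u (p + (1, 0)) = w (p + (1, 0)) ∧
      u (p + (1, 1)) - u (p + (0, 1)) = h (p + (0, 1)) := by
  have := contractible_region hS
  let F : ℝ × ℝ → AddCircle (1 : ℝ) := fun x => (bil h w (⌊x.1⌋, ⌊x.2⌋) x : AddCircle (1 : ℝ))
  have hF : ContinuousOn F (Region S) := by
    apply continuousOn_region
    intro p hp
    refine ContinuousOn.congr (f := fun x => (bil h w p x : AddCircle (1 : ℝ))) ?_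
      (fun x hx => bil_floor h w p (hc p hp) x hx)
    exact ((AddCircle.isCoveringMap_coe (1 : ℝ)).continuous.comp
      (bil_continuous h w p)).continuousOn
  obtain ⟨g, hg⟩ := exists_real_lift (A := Region S) ⟨_, hF.domRestrict⟩
  have hg' : ∀ x : Region S, (g x : AddCircle (1 : ℝ)) = F x := hg
  classical
  let G : ℝ × ℝ → ℝ := fun x => if hx : x ∈ Region S then g ⟨x, hx⟩ else 0
  have hGv : ∀ x (hx : x ∈ Region S), G x = g ⟨x, hx⟩ := fun x hx => dif_pos hx
  have hGc : ContinuousOn G (Region S) := by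
    rw [continuousOn_iff_continuous_domRestrict]
    convert g.continuous using 1
    ext x
    simp [G]
  have hG : ∀ p ∈ S, ∀ x ∈ unitSquare p, (G x : AddCircle (1 : ℝ)) = bil h w p x := by
    intro p hp x hx
    rw [hGv x (unitSquare_subset hp hx), hg', ← bil_floor h w p (hc p hp) x hx]
  have hconst : ∀ p ∈ S, ∀ x ∈ unitSquare p, ∀ y ∈ unitSquare p,
      G x - bil h w p x = G y - bil h w p y := by
    intro p hp x hx y hy
    have hpc : IsPreconnected (unitSquare p) := isPreconnected_Icc.prod isPreconnected_Icc
    have hcont : ContinuousOn (fun x => G x - bil h w p x) (unitSquare p) :=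
      (hGc.mono (unitSquare_subset hp)).sub (bil_continuous h w p).continuousOn
    refine hpc.constant_of_mapsTo (T := Set.range ((↑) : ℤ → ℝ)) ?_ hcont ?_ hx hy
    · rw [isDiscrete_iff_discreteTopology]
      exact (Int.isClosedEmbedding_coe_real.isEmbedding.toHomeomorph).symm.isEmbedding.discreteTopology
    · intro z hz
      obtain ⟨n, hn⟩ := int_of_coe_eq (hG p hp z hz)
      exact ⟨n, hn.symm⟩
  have hbil : ∀ p : Cell, bil h w p (toR p) = 0 ∧ bil h w p (toR (p + (1, 0))) = h p ∧
      bil h w p (toR (p + (0, 1))) = w p ∧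
      bil h w p (toR (p + (1, 1))) = h p + w (p + (1, 0)) := by
    rintro ⟨a, b⟩
    simp [bil, toR]
  have hmem : ∀ p : Cell, toR p ∈ unitSquare p ∧ toR (p + (1, 0)) ∈ unitSquare p ∧
      toR (p + (0, 1)) ∈ unitSquare p ∧ toR (p + (1, 1)) ∈ unitSquare p := by
    rintro ⟨a, b⟩
    simp [unitSquare, toR]
  refine ⟨fun v => ⌊G (toR v)⌋, fun p hp => ?_⟩
  obtain ⟨m0, m1, m2, m3⟩ := hmem p
  obtain ⟨b0, b1, b2, b3⟩ := hbil p
  obtain ⟨n, hn⟩ := int_of_coe_eq (hG p hp _ m0)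
  have c1 := hconst p hp _ m1 _ m0
  have c2 := hconst p hp _ m2 _ m0
  have c3 := hconst p hp _ m3 _ m0
  rw [b0] at hn
  rw [b0, b1] at c1
  rw [b0, b2] at c2
  rw [b0, b3] at c3
  have e0 : ⌊G (toR p)⌋ = n := by
    rw [show G (toR p) = (n : ℤ) by linarith]; exact Int.floor_intCast n
  have e1 : ⌊G (toR (p + (1, 0)))⌋ = n + h p := by
    rw [show G (toR (p + (1, 0))) = ((n + h p : ℤ) : ℝ) by push_cast; linarith]
    exact Int.floor_intCast _
  have e2 : ⌊G (toR (p + (0, 1)))⌋ = n + w p := by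
    rw [show G (toR (p + (0, 1))) = ((n + w p : ℤ) : ℝ) by push_cast; linarith]
    exact Int.floor_intCast _
  have e3 : ⌊G (toR (p + (1, 1)))⌋ = n + h p + w (p + (1, 0)) := by
    rw [show G (toR (p + (1, 1))) = ((n + h p + w (p + (1, 0)) : ℤ) : ℝ) by push_cast; linarith]
    exact Int.floor_intCast _
  have := hc p hp
  simp only [e0, e1, e2, e3]
  refine ⟨?_, ?_, ?_, ?_⟩ <;> linarith

/-! ### Euler characteristic -/

/-- Left endpoints of horizontal edges of `S`. -/
def hEdges (S : Finset Cell) : Finset Cell := S ∪ S.image (· + (0, 1))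

/-- Lower endpoints of vertical edges of `S`. -/
def vEdges (S : Finset Cell) : Finset Cell := S ∪ S.image (· + (1, 0))

/-- All vertices of `S`. -/
def allVerts (S : Finset Cell) : Finset Cell := hEdges S ∪ (hEdges S).image (· + (1, 0))

theorem mem_image_add {T : Finset Cell} {a v : Cell} : v ∈ T.image (· + a) ↔ v - a ∈ T := by
  simp only [Finset.mem_image]
  constructor
  · rintro ⟨t, ht, rfl⟩; simpa using ht
  · intro h; exact ⟨v - a, h, by simp⟩

theorem mem_hEdges {S : Finset Cell} {v : Cell} : v ∈ hEdges S ↔ v ∈ S ∨ v - (0, 1) ∈ S := by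
  rw [hEdges, Finset.mem_union, mem_image_add]

theorem mem_vEdges {S : Finset Cell} {v : Cell} : v ∈ vEdges S ↔ v ∈ S ∨ v - (1, 0) ∈ S := by
  rw [vEdges, Finset.mem_union, mem_image_add]

theorem sub_sub_10_01 (v : Cell) : v - (1, 0) - (0, 1) = v - (1, 1) := by
  ext <;> simp

theorem sub_sub_01_10 (v : Cell) : v - (0, 1) - (1, 0) = v - (1, 1) := by
  ext <;> simp

theorem mem_allVerts {S : Finset Cell} {v : Cell} : v ∈ allVerts S ↔
    v ∈ S ∨ v - (1, 0) ∈ S ∨ v - (0, 1) ∈ S ∨ v - (1, 1) ∈ S := by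
  rw [allVerts, Finset.mem_union, mem_image_add, mem_hEdges, mem_hEdges, sub_sub_10_01]
  tauto

theorem mem_h1 {S : Finset Cell} {p : Cell} (hp : p ∈ S) : p ∈ hEdges S := mem_hEdges.2 (.inl hp)
theorem mem_h2 {S : Finset Cell} {p : Cell} (hp : p ∈ S) : p + (0, 1) ∈ hEdges S :=
  mem_hEdges.2 (.inr (by simpa using hp))
theorem mem_v1 {S : Finset Cell} {p : Cell} (hp : p ∈ S) : p ∈ vEdges S := mem_vEdges.2 (.inl hp)
theorem mem_v2 {S : Finset Cell} {p : Cell} (hp : p ∈ S) : p + (1, 0) ∈ vEdges S :=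
  mem_vEdges.2 (.inr (by simpa using hp))
theorem mem_a1 {S : Finset Cell} {p : Cell} (hp : p ∈ hEdges S) : p ∈ allVerts S :=
  Finset.mem_union_left _ hp
theorem mem_a2 {S : Finset Cell} {p : Cell} (hp : p ∈ hEdges S) : p + (1, 0) ∈ allVerts S :=
  Finset.mem_union_right _ (mem_image_add.2 (by simpa using hp))
theorem mem_a3 {S : Finset Cell} {p : Cell} (hp : p ∈ vEdges S) : p ∈ allVerts S := by
  rw [mem_vEdges] at hp; rw [mem_allVerts]; tauto
theorem mem_a4 {S : Finset Cell} {p : Cell} (hp : p ∈ vEdges S) : p + (0, 1) ∈ allVerts S := by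
  rw [mem_vEdges] at hp; rw [mem_allVerts, ← sub_sub_01_10, add_sub_cancel_right]; tauto

/-- The coboundary from vertices to edges. -/
def cob0 (S : Finset Cell) :
    (allVerts S → ℤ) →ₗ[ℤ] ((hEdges S → ℤ) × (vEdges S → ℤ)) where
  toFun u := (fun e => u ⟨_, mem_a2 e.2⟩ - u ⟨_, mem_a1 e.2⟩,
    fun e => u ⟨_, mem_a4 e.2⟩ - u ⟨_, mem_a3 e.2⟩)
  map_add' u v := by ext e <;> simp <;> ring
  map_smul' r u := by ext e <;> simp <;> ring

/-- The coboundary from edges to cells. -/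
def cob1 (S : Finset Cell) :
    ((hEdges S → ℤ) × (vEdges S → ℤ)) →ₗ[ℤ] (S → ℤ) where
  toFun f := fun p => f.1 ⟨_, mem_h1 p.2⟩ + f.2 ⟨_, mem_v2 p.2⟩ - f.2 ⟨_, mem_v1 p.2⟩
    - f.1 ⟨_, mem_h2 p.2⟩
  map_add' u v := by ext e; simp; ring
  map_smul' r u := by ext e; simp; ring

theorem ker_le_range {S : Finset Cell} (hS : IsBoard S) :
    LinearMap.ker (cob1 S) ≤ LinearMap.range (cob0 S) := by
  classical
  rintro ⟨h, w⟩ hf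
  rw [LinearMap.mem_ker] at hf
  let h' : Cell → ℤ := fun v => if hv : v ∈ hEdges S then h ⟨v, hv⟩ else 0
  let w' : Cell → ℤ := fun v => if hv : v ∈ vEdges S then w ⟨v, hv⟩ else 0
  have hh : ∀ v (hv : v ∈ hEdges S), h' v = h ⟨v, hv⟩ := fun v hv => dif_pos hv
  have hw : ∀ v (hv : v ∈ vEdges S), w' v = w ⟨v, hv⟩ := fun v hv => dif_pos hv
  obtain ⟨u, hu⟩ := exact_of_closed hS h' w' (by
    intro p hp
    rw [hh _ (mem_h1 hp), hh _ (mem_h2 hp), hw _ (mem_v1 hp), hw _ (mem_v2 hp)]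
    have := congr_fun hf ⟨p, hp⟩
    simp only [cob1, LinearMap.coe_mk, AddHom.coe_mk, Pi.zero_apply] at this
    linarith)
  refine ⟨fun v => u v, ?_⟩
  have key1 : ∀ v (hv : v ∈ hEdges S), u (v + (1, 0)) - u v = h ⟨v, hv⟩ := by
    intro v hv
    rw [← hh]
    rcases mem_hEdges.1 hv with h1 | h1
    · exact (hu v h1).1
    · have := (hu _ h1).2.2.2
      rw [sub_add_cancel] at this
      rwa [show v + (1, 0) = v - (0, 1) + (1, 1) by ext <;> simp]
  have key2 : ∀ v (hv : v ∈ vEdges S), u (v + (0, 1)) - u v = w ⟨v, hv⟩ := by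
    intro v hv
    rw [← hw]
    rcases mem_vEdges.1 hv with h1 | h1
    · exact (hu v h1).2.1
    · have := (hu _ h1).2.2.1
      rw [sub_add_cancel] at this
      rwa [show v + (0, 1) = v - (1, 0) + (1, 1) by ext <;> simp]
  ext e
  · exact key1 e.1 e.2
  · exact key2 e.1 e.2

theorem rank_nullity_dom {A M N : Type} [CommRing A] [IsDomain A] [AddCommGroup M]
    [AddCommGroup N] [Module A M] [Module A N] [Module.Finite A M] (f : M →ₗ[A] N) :
    Module.finrank A (LinearMap.range f) + Module.finrank A (LinearMap.ker f)
      = Module.finrank A M := by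
  rw [← f.quotKerEquivRange.finrank_eq]
  exact Submodule.finrank_quotient_add_finrank _

theorem euler_ineq {S : Finset Cell} (hS : IsBoard S) :
    (hEdges S).card + (vEdges S).card + 1 ≤ (allVerts S).card + S.card := by
  have r0 := rank_nullity_dom (cob0 S)
  have r1 := rank_nullity_dom (cob1 S)
  have l1 := Submodule.finrank_le (LinearMap.range (cob1 S))
  have l2 := Submodule.finrank_mono (ker_le_range hS)
  simp only [Module.finrank_prod, Module.finrank_pi, Fintype.card_coe] at r0 r1 l1
  have l3 : 0 < Module.finrank ℤ (LinearMap.ker (cob0 S)) := by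
    obtain ⟨⟨p, hp⟩, _⟩ := hS
    have : Nontrivial (LinearMap.ker (cob0 S)) := by
      refine ⟨⟨⟨fun _ => 1, ?_⟩, 0, ?_⟩⟩
      · rw [LinearMap.mem_ker]; ext e <;> simp [cob0]
      · intro h
        have := congr_fun (congr_arg Subtype.val h) ⟨p, mem_a1 (mem_h1 hp)⟩
        simp at this
    exact Module.finrank_pos
  omega

theorem sum_shift {T U : Finset Cell} {a : Cell} (h : ∀ t ∈ T, t + a ∈ U) :
    ∑ v ∈ U, (if v - a ∈ T then 1 else 0 : ℤ) = T.card := by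
  rw [Finset.sum_boole]
  have : U.filter (fun v => v - a ∈ T) = T.image (· + a) := by
    ext v
    rw [Finset.mem_filter, mem_image_add]
    refine ⟨fun h => h.2, fun h' => ⟨by simpa using h _ h', h'⟩⟩
  rw [this, Finset.card_image_of_injective _ (add_left_injective a)]

theorem sum_shift0 {T U : Finset Cell} (h : ∀ t ∈ T, t ∈ U) :
    ∑ v ∈ U, (if v ∈ T then 1 else 0 : ℤ) = T.card := by
  simpa using sum_shift (a := 0) (T := T) (U := U) (by simpa using h)

theorem mem_cellVerts {v p : Cell} : v ∈ cellVerts p ↔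
    p = v ∨ p = v - (1, 0) ∨ p = v - (0, 1) ∨ p = v - (1, 1) := by
  simp only [cellVerts, Finset.mem_insert, Finset.mem_singleton, eq_sub_iff_add_eq]
  tauto

theorem incident_card (S : Finset Cell) (v : Cell) : (incidentCells S v).card =
    (if v ∈ S then 1 else 0) + (if v - (1, 0) ∈ S then 1 else 0)
    + (if v - (0, 1) ∈ S then 1 else 0) + (if v - (1, 1) ∈ S then 1 else 0) := by
  have : incidentCells S v =
      ({v, v - (1, 0), v - (0, 1), v - (1, 1)} : Finset Cell).filter (· ∈ S) := by
    ext p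
    simp only [incidentCells, Finset.mem_filter, mem_cellVerts, Finset.mem_insert,
      Finset.mem_singleton]
    tauto
  rw [this, Finset.card_filter]
  rw [Finset.sum_insert, Finset.sum_insert, Finset.sum_insert, Finset.sum_singleton]
  · ring
  all_goals
    obtain ⟨a, b⟩ := v
    simp
    try omega

theorem corners_ge {S : Finset Cell} (hS : IsBoard S) :
    ((allVerts S).filter fun v => (incidentCells S v).card = 3).card + 4 ≤
    ((allVerts S).filter fun v => (incidentCells S v).card = 1).card := by
  have he := euler_ineq hS
  have s1 := sum_shift0 (T := S) (U := allVerts S) fun t ht => mem_a1 (mem_h1 ht)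
  have s2 := sum_shift (T := S) (U := allVerts S) (a := (1, 0)) fun t ht => mem_a2 (mem_h1 ht)
  have s3 := sum_shift (T := S) (U := allVerts S) (a := (0, 1)) fun t ht => mem_a1 (mem_h2 ht)
  have s4 := sum_shift (T := S) (U := allVerts S) (a := (1, 1)) fun t ht => by
    rw [mem_allVerts]; right; right; right; simpa using ht
  have s5 := sum_shift0 (T := hEdges S) (U := allVerts S) fun t ht => mem_a1 ht
  have s6 := sum_shift (T := hEdges S) (U := allVerts S) (a := (1, 0)) fun t ht => mem_a2 ht
  have s7 := sum_shift0 (T := vEdges S) (U := allVerts S) fun t ht => mem_a3 ht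
  have s8 := sum_shift (T := vEdges S) (U := allVerts S) (a := (0, 1)) fun t ht => mem_a4 ht
  have s9 := sum_shift0 (T := allVerts S) (U := allVerts S) fun t ht => ht
  have key : ∑ v ∈ allVerts S, (4 * (if v ∈ allVerts S then 1 else 0 : ℤ)
      - 2 * ((if v ∈ hEdges S then 1 else 0 : ℤ) + (if v - (1, 0) ∈ hEdges S then 1 else 0 : ℤ)
        + (if v ∈ vEdges S then 1 else 0 : ℤ) + (if v - (0, 1) ∈ vEdges S then 1 else 0 : ℤ))
      + ((if v ∈ S then 1 else 0 : ℤ) + (if v - (1, 0) ∈ S then 1 else 0 : ℤ)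
        + (if v - (0, 1) ∈ S then 1 else 0 : ℤ) + (if v - (1, 1) ∈ S then 1 else 0 : ℤ)))
      ≤ ∑ v ∈ allVerts S, ((if (incidentCells S v).card = 1 then 1 else 0 : ℤ)
        - (if (incidentCells S v).card = 3 then 1 else 0 : ℤ)) := by
    apply Finset.sum_le_sum
    intro v hv
    rw [incident_card]
    simp only [mem_hEdges, mem_vEdges, sub_sub_10_01, sub_sub_01_10]
    rw [if_pos hv]
    rw [mem_allVerts] at hv
    by_cases a : v ∈ S <;> by_cases b : v - (1, 0) ∈ S <;> by_cases c : v - (0, 1) ∈ S <;>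
      by_cases d : v - (1, 1) ∈ S <;> simp_all
  simp only [Finset.sum_add_distrib, Finset.sum_sub_distrib, ← Finset.mul_sum] at key
  rw [s1, s2, s3, s4, s5, s6, s7, s8, s9, Finset.sum_boole, Finset.sum_boole] at key
  omega

/-! ### Local topology of the region -/

theorem square_subset_closure_compl {S : Finset Cell} {q : Cell} (hq : q ∉ S) :
    unitSquare q ⊆ closure (Region S)ᶜ := by
  have h1 : (Set.Ioo (q.1 : ℝ) (q.1 + 1)) ×ˢ (Set.Ioo (q.2 : ℝ) (q.2 + 1)) ⊆ (Region S)ᶜ := by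
    rintro ⟨x, y⟩ ⟨⟨a, b⟩, c, d⟩ hx
    simp only [Region, Set.mem_iUnion] at hx
    obtain ⟨p, hp, ⟨e, f⟩, g, h⟩ := hx
    simp only at a b c d e f g h
    apply hq
    have i1 : q.1 < p.1 + 1 := by exact_mod_cast a.trans_le f
    have i2 : p.1 < q.1 + 1 := by exact_mod_cast e.trans_lt b
    have i3 : q.2 < p.2 + 1 := by exact_mod_cast c.trans_le h
    have i4 : p.2 < q.2 + 1 := by exact_mod_cast g.trans_lt d
    have : q = p := by ext <;> omega
    rwa [this]
  have h2 := closure_mono h1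
  rwa [closure_prod_eq, closure_Ioo (by simp), closure_Ioo (by simp)] at h2

theorem frontier_of_mem {S : Finset Cell} {p q : Cell} (hp : p ∈ S) (hq : q ∉ S) :
    unitSquare p ∩ unitSquare q ⊆ frontier (Region S) := by
  intro x hx
  rw [frontier_eq_closure_inter_closure]
  exact ⟨subset_closure (unitSquare_subset hp hx.1), square_subset_closure_compl hq hx.2⟩

/-- `e` has both coordinates in `{0, 1}`. -/
def IsDir (e : Cell) : Prop := (e.1 = 0 ∨ e.1 = 1) ∧ (e.2 = 0 ∨ e.2 = 1)

/-- The cell incident to `v` in the quadrant `e`. -/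
def quad (v e : Cell) : Cell := v + e - (1, 1)

/-- All four cells at `v` are in `S`. -/
def Full (S : Finset Cell) (v : Cell) : Prop := ∀ e, IsDir e → quad v e ∈ S

/-- The `i`-th vertex on the ray from `c` in direction `e`. -/
def ray (c e : Cell) (i : ℕ) : Cell := (c.1 + i * (2 * e.1 - 1), c.2 + i * (2 * e.2 - 1))

theorem isDir_cases {P : Cell → Prop} (h0 : P (0, 0)) (h1 : P (1, 0)) (h2 : P (0, 1))
    (h3 : P (1, 1)) : ∀ e, IsDir e → P e := by
  rintro ⟨a, b⟩ ⟨rfl | rfl, rfl | rfl⟩ <;> assumption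

theorem full_iff {S : Finset Cell} {v : Cell} : Full S v ↔
    v ∈ S ∧ v - (1, 0) ∈ S ∧ v - (0, 1) ∈ S ∧ v - (1, 1) ∈ S := by
  have e0 : quad v (0, 0) = v - (1, 1) := by ext <;> simp [quad]
  have e1 : quad v (1, 0) = v - (0, 1) := by ext <;> simp [quad]
  have e2 : quad v (0, 1) = v - (1, 0) := by ext <;> simp [quad]
  have e3 : quad v (1, 1) = v := by ext <;> simp [quad]
  constructor
  · intro h
    refine ⟨e3 ▸ h _ ?_, e2 ▸ h _ ?_, e1 ▸ h _ ?_, e0 ▸ h _ ?_⟩ <;> simp [IsDir]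
  · rintro ⟨a, b, c, d⟩
    apply isDir_cases
    · rwa [e0]
    · rwa [e1]
    · rwa [e2]
    · rwa [e3]

theorem mem_cellVerts_quad {v e : Cell} (he : IsDir e) : v ∈ cellVerts (quad v e) := by
  rw [mem_cellVerts]
  obtain ⟨a, b⟩ := e
  obtain ⟨c, d⟩ := v
  obtain ⟨rfl | rfl, rfl | rfl⟩ := he <;> simp [quad]

theorem toR_mem {v p : Cell} (h : v ∈ cellVerts p) : toR v ∈ unitSquare p := by
  rw [mem_cellVerts] at h
  obtain ⟨c, d⟩ := v
  rcases h with rfl | rfl | rfl | rfl <;> simp [toR, unitSquare]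

theorem interior_iff {S : Finset Cell} {v : Cell} : IsInteriorVertex S v ↔ Full S v := by
  constructor
  · rintro ⟨⟨p, hp, hv⟩, h⟩ e he
    by_contra hq
    exact h (frontier_of_mem hp hq ⟨toR_mem hv, toR_mem (mem_cellVerts_quad he)⟩)
  · intro h
    rw [full_iff] at h
    obtain ⟨h0, h1, h2, h3⟩ := h
    refine ⟨⟨v, h0, by simp [cellVerts]⟩, fun hf => hf.2 ?_⟩
    rw [mem_interior]
    refine ⟨(Set.Ioo (v.1 - 1 : ℝ) (v.1 + 1)) ×ˢ (Set.Ioo (v.2 - 1 : ℝ) (v.2 + 1)), ?_,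
      isOpen_Ioo.prod isOpen_Ioo, by simp [toR]⟩
    rintro ⟨x, y⟩ ⟨⟨a, b⟩, c, d⟩
    simp only at a b c d
    rcases le_total x v.1 with hx | hx <;> rcases le_total y v.2 with hy | hy
    · apply unitSquare_subset h3
      simp only [unitSquare, Set.mem_prod, Set.mem_Icc, Prod.fst_sub, Prod.snd_sub]
      push_cast
      refine ⟨⟨?_, ?_⟩, ?_, ?_⟩ <;> linarith
    · apply unitSquare_subset h1
      simp only [unitSquare, Set.mem_prod, Set.mem_Icc, Prod.fst_sub, Prod.snd_sub]
      push_cast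
      refine ⟨⟨?_, ?_⟩, ?_, ?_⟩ <;> linarith
    · apply unitSquare_subset h2
      simp only [unitSquare, Set.mem_prod, Set.mem_Icc, Prod.fst_sub, Prod.snd_sub]
      push_cast
      refine ⟨⟨?_, ?_⟩, ?_, ?_⟩ <;> linarith
    · apply unitSquare_subset h0
      simp only [unitSquare, Set.mem_prod, Set.mem_Icc]
      refine ⟨⟨?_, ?_⟩, ?_, ?_⟩ <;> linarith

theorem segment_subset_square {a b p : Cell} (ha : a ∈ cellVerts p) (hb : b ∈ cellVerts p) :
    segment ℝ (toR a) (toR b) ⊆ unitSquare p :=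
  ((convex_Icc _ _).prod (convex_Icc _ _)).segment_subset (toR_mem ha) (toR_mem hb)

/-! ### Diagonals -/

theorem exists_not_full (S : Finset Cell) (c e : Cell) :
    ∃ k : ℕ, 1 ≤ k ∧ ¬ Full S (ray c e k) := by
  by_contra! h
  have hm : ∀ k : ℕ, ray c e (k + 1) ∈ S := fun k => (full_iff.1 (h (k + 1) (by omega))).1
  have hinj : Function.Injective fun k : ℕ => (⟨ray c e (k + 1), hm k⟩ : S) := by
    intro i j hij
    have h1 := congr_arg Prod.fst (congr_arg Subtype.val hij)
    simp only [ray, add_right_inj] at h1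
    have h2 : (2 * e.1 - 1) ≠ 0 := by omega
    have := mul_right_cancel₀ h2 h1
    omega
  exact not_injective_infinite_finite _ hinj

theorem corner_dir {S : Finset Cell} {c : Cell} (hc : IsBoardCorner S c) :
    ∃ e, IsDir e ∧ quad c e ∈ S := by
  have : (incidentCells S c).Nonempty := by
    rw [← Finset.card_pos, hc]; exact one_pos
  obtain ⟨p, hp⟩ := this
  simp only [incidentCells, Finset.mem_filter, mem_cellVerts] at hp
  obtain ⟨hp, rfl | rfl | rfl | rfl⟩ := hp
  · exact ⟨(1, 1), by simp [IsDir], by simpa [quad] using hp⟩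
  · exact ⟨(0, 1), by simp [IsDir], by convert hp using 1; ext <;> simp [quad]⟩
  · exact ⟨(1, 0), by simp [IsDir], by convert hp using 1; ext <;> simp [quad]⟩
  · exact ⟨(0, 0), by simp [IsDir], by convert hp using 1; ext <;> simp [quad]⟩

theorem ray_opposite {c e : Cell} (he : IsDir e) (i : ℕ) :
    OppositeVerts (quad (ray c e i) e) (ray c e i) (ray c e (i + 1)) := by
  revert e
  apply isDir_cases
  · left; rw [Finset.pair_comm]; congr 1
    · ext <;> simp [ray, quad] <;> ring
    · congr 1; ext <;> simp [ray, quad]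
  · right; rw [Finset.pair_comm]; congr 1
    · ext <;> simp [ray, quad] <;> ring
    · congr 1; ext <;> simp [ray, quad]
  · right; congr 1
    · ext <;> simp [ray, quad]
    · congr 1; ext <;> simp [ray, quad] <;> ring
  · left; congr 1
    · ext <;> simp [ray, quad]
    · congr 1; ext <;> simp [ray, quad] <;> ring

theorem ray_inter {c e : Cell} (he : IsDir e) (i : ℕ) :
    (cellVerts (quad (ray c e i) e) ∩ cellVerts (quad (ray c e (i + 1)) e)).card = 1 := by
  rw [Finset.card_eq_one]
  refine ⟨ray c e (i + 1), ?_⟩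
  ext ⟨x, y⟩
  revert e
  apply isDir_cases <;>
  · simp only [Finset.mem_inter, mem_cellVerts, Finset.mem_singleton, ray, quad, Prod.ext_iff,
      Prod.fst_sub, Prod.snd_sub, Prod.fst_add, Prod.snd_add]
    push_cast
    omega

theorem ray_inj {c e : Cell} {i j : ℕ} (h : i ≠ j) : ray c e i ≠ ray c e j := by
  intro hij
  have h1 := congr_arg Prod.fst hij
  simp only [ray, add_right_inj] at h1
  have h2 : (2 * e.1 - 1) ≠ 0 := by omega
  have := mul_right_cancel₀ h2 h1
  omega

theorem ray_zero (c e : Cell) : ray c e 0 = c := by simp [ray]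

theorem ray_isDiagonal {S : Finset Cell} {c e : Cell} (hc : IsBoardCorner S c) (he : IsDir e)
    (hq : quad c e ∈ S) {k : ℕ} (hk : 1 ≤ k) (hf : ¬ Full S (ray c e k))
    (hlt : ∀ i, 0 < i → i < k → Full S (ray c e i)) :
    IsDiagonal S k (ray c e) (fun i => quad (ray c e i) e) := by
  refine ⟨⟨hk, ?_, ?_, ?_, ?_, ?_, ?_, ?_⟩, ?_⟩
  · rwa [ray_zero]
  · intro i h1 h2; exact interior_iff.2 (hlt i h1 h2)
  · intro i hi
    rcases Nat.eq_zero_or_pos i with rfl | h0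
    · simpa only [ray_zero] using hq
    · exact hlt i h0 hi e he
  · intro i _; exact ray_opposite he i
  · intro i _; exact ray_inter he i
  · intro i j _ _ hij; exact ray_inj hij
  · intro i j _ _ hij h
    apply ray_inj (c := c) (e := e) hij
    simpa [quad] using h
  · intro k' v' s' hp hext
    obtain ⟨h1, h2, h3⟩ := hext
    by_contra hne
    have := hp.2.2.1 k (by omega) (by omega)
    rw [h2 k le_rfl, interior_iff] at this
    exact hf this

/-- A corner without good diagonal gives a diagonal ending at a reflex vertex. -/
theorem good_or_reflex {S : Finset Cell} {c : Cell} (hc : IsBoardCorner S c) :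
    (∃ (k : ℕ) (v s : ℕ → Cell), IsGoodDiagonal S k v s ∧ v 0 = c) ∨
    ∃ (e : Cell) (k : ℕ), IsDir e ∧ 1 ≤ k ∧ (∀ i, 0 < i → i < k → Full S (ray c e i)) ∧
      quad (ray c e k) e ∉ S ∧ ∀ e', IsDir e' → e' ≠ e → quad (ray c e k) e' ∈ S := by
  classical
  obtain ⟨e, he, hq⟩ := corner_dir hc
  let k := Nat.find (exists_not_full S c e)
  obtain ⟨hk, hf⟩ : 1 ≤ k ∧ ¬ Full S (ray c e k) := Nat.find_spec (exists_not_full S c e)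
  have hlt : ∀ i, 0 < i → i < k → Full S (ray c e i) := by
    intro i h0 hi
    have := Nat.find_min (exists_not_full S c e) hi
    by_contra h
    exact this ⟨h0, h⟩
  have hd := ray_isDiagonal hc he hq hk hf hlt
  set r := ray c e k with hr
  have hlast : quad (ray c e (k - 1)) e = quad r (1 - e.1, 1 - e.2) := by
    rw [hr]
    simp only [ray, quad]
    push_cast [hk]
    ext <;> simp <;> ring
  have hlS : quad r (1 - e.1, 1 - e.2) ∈ S := by
    rw [← hlast]; exact hd.1.2.2.2.1 (k - 1) (by omega)
  have hD : ∀ {x : Cell}, IsDir (1 - e.1, 1 - e.2) ∧ IsDir (e.1, 1 - e.2) ∧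
      IsDir (1 - e.1, e.2) := by
    intro _
    simp only [IsDir] at he ⊢
    omega
  obtain ⟨d1, d2, d3⟩ := hD (x := e)
  by_cases h1 : quad r (e.1, 1 - e.2) ∈ S
  · by_cases h2 : quad r (1 - e.1, e.2) ∈ S
    · right
      have h3 : ∀ e', IsDir e' → e' ≠ e → quad r e' ∈ S := by
        intro e' he' hne
        have : e' = (1 - e.1, 1 - e.2) ∨ e' = (e.1, 1 - e.2) ∨ e' = (1 - e.1, e.2) := by
          simp only [IsDir, Prod.ext_iff, ne_eq] at he he' hne ⊢
          omega
        rcases this with rfl | rfl | rfl <;> assumption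
      refine ⟨e, k, he, hk, hlt, fun h => hf ?_, h3⟩
      intro e' he'
      by_cases hee : e' = e
      · rwa [hee]
      · exact h3 e' he' hee
    · left
      refine ⟨k, _, _, ⟨hd, (r.1 + (1 - 2 * e.1), r.2), ?_, ?_, ?_⟩, ray_zero c e⟩
      · change _ ∈ cellVerts (quad (ray c e (k - 1)) e)
        rw [hlast]
        simp only [mem_cellVerts, quad, Prod.ext_iff, Prod.fst_sub, Prod.snd_sub,
          Prod.fst_add, Prod.snd_add]
        simp only [IsDir] at he
        omega
      · simp only [← hr, Prod.ext_iff, Prod.fst_sub, Prod.snd_sub]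
        simp only [IsDir] at he
        omega
      · refine subset_trans (Set.subset_inter ?_ ?_) (frontier_of_mem hlS h2)
        all_goals
          apply segment_subset_square
          · exact mem_cellVerts_quad (by assumption)
          · simp only [mem_cellVerts, quad, Prod.ext_iff, Prod.fst_sub, Prod.snd_sub,
              Prod.fst_add, Prod.snd_add]
            simp only [IsDir] at he
            omega
  · left
    refine ⟨k, _, _, ⟨hd, (r.1, r.2 + (1 - 2 * e.2)), ?_, ?_, ?_⟩, ray_zero c e⟩
    · change _ ∈ cellVerts (quad (ray c e (k - 1)) e)
      rw [hlast]
      simp only [mem_cellVerts, quad, Prod.ext_iff, Prod.fst_sub, Prod.snd_sub,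
        Prod.fst_add, Prod.snd_add]
      simp only [IsDir] at he
      omega
    · simp only [← hr, Prod.ext_iff, Prod.fst_sub, Prod.snd_sub]
      simp only [IsDir] at he
      omega
    · refine subset_trans (Set.subset_inter ?_ ?_) (frontier_of_mem hlS h1)
      all_goals
        apply segment_subset_square
        · exact mem_cellVerts_quad (by assumption)
        · simp only [mem_cellVerts, quad, Prod.ext_iff, Prod.fst_sub, Prod.snd_sub,
            Prod.fst_add, Prod.snd_add]
          simp only [IsDir] at he
          omega

theorem reflex_card {S : Finset Cell} {r e : Cell} (he : IsDir e) (h0 : quad r e ∉ S)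
    (h1 : ∀ e', IsDir e' → e' ≠ e → quad r e' ∈ S) : (incidentCells S r).card = 3 := by
  have e0 : quad r (0, 0) = r - (1, 1) := by ext <;> simp [quad]
  have e1 : quad r (1, 0) = r - (0, 1) := by ext <;> simp [quad]
  have e2 : quad r (0, 1) = r - (1, 0) := by ext <;> simp [quad]
  have e3 : quad r (1, 1) = r := by ext <;> simp [quad]
  have a0 := h1 (0, 0) (by simp [IsDir])
  have a1 := h1 (1, 0) (by simp [IsDir])
  have a2 := h1 (0, 1) (by simp [IsDir])
  have a3 := h1 (1, 1) (by simp [IsDir])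
  clear h1
  rw [e0] at a0
  rw [e1] at a1
  rw [e2] at a2
  rw [e3] at a3
  rw [incident_card]
  obtain ⟨a, b⟩ := e
  obtain ⟨rfl | rfl, rfl | rfl⟩ := he <;> simp_all

theorem not_full_of_corner {S : Finset Cell} {c : Cell} (hc : IsBoardCorner S c) :
    ¬ Full S c := by
  intro h
  rw [full_iff] at h
  obtain ⟨a, b, d, f⟩ := h
  have := incident_card S c
  rw [hc, if_pos a, if_pos b, if_pos d, if_pos f] at this
  omega

theorem ray_back {c c' e : Cell} {k k' : ℕ} (h : ray c e k = ray c' e k') (hle : k ≤ k') :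
    c = ray c' e (k' - k) := by
  simp only [ray, Prod.ext_iff] at h ⊢
  push_cast [hle]
  constructor
  · linear_combination h.1
  · linear_combination h.2

/-- **Proposition.** Every board admits at least four good diagonals.  (Since a
diagonal is determined by its starting corner, distinct starting corners give
distinct diagonals.) -/
theorem exists_four_good_diagonals
    (S : Finset Cell) (hS : IsBoard S) :
    ∃ c : Fin 4 → Cell, Function.Injective c ∧
      ∀ t : Fin 4, ∃ (k : ℕ) (v s : ℕ → Cell),
        IsGoodDiagonal S k v s ∧ v 0 = c t := by
  classical
  let C := (allVerts S).filter fun v => (incidentCells S v).card = 1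
  let R := (allVerts S).filter fun v => (incidentCells S v).card = 3
  let P : Cell → Prop := fun c =>
    ∃ (k : ℕ) (v s : ℕ → Cell), IsGoodDiagonal S k v s ∧ v 0 = c
  have hCR : R.card + 4 ≤ C.card := corners_ge hS
  have hsplit := Finset.card_filter_add_card_filter_not (s := C) P
  have hbad : (C.filter fun c => ¬ P c).card ≤ R.card := by
    have hex : ∀ c, c ∈ C.filter (fun c => ¬ P c) →
        ∃ (e : Cell) (k : ℕ), IsDir e ∧ 1 ≤ k ∧ (∀ i, 0 < i → i < k → Full S (ray c e i)) ∧
        quad (ray c e k) e ∉ S ∧ ∀ e', IsDir e' → e' ≠ e → quad (ray c e k) e' ∈ S := by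
      intro c hc
      simp only [C, Finset.mem_filter] at hc
      exact (good_or_reflex hc.1.2).resolve_left hc.2
    choose! e k h1 h2 h3 h4 h5 using hex
    refine Finset.card_le_card_of_injOn (fun c => ray c (e c) (k c)) ?_ ?_
    · intro c hc
      have hr := reflex_card (h1 c hc) (h4 c hc) (h5 c hc)
      simp only [R, Finset.coe_filter, Set.mem_ofPred_eq]
      refine ⟨?_, hr⟩
      rw [mem_allVerts]
      by_contra! hn
      rw [incident_card, if_neg hn.1, if_neg hn.2.1, if_neg hn.2.2.1, if_neg hn.2.2.2] at hr
      omega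
    · intro c hc c' hc' heq
      have heq : ray c (e c) (k c) = ray c' (e c') (k c') := heq
      have hcc : IsBoardCorner S c := by
        have := hc; simp only [C, Finset.coe_filter, Finset.mem_filter, Set.mem_ofPred_eq] at this
        exact this.1.2
      have hcc' : IsBoardCorner S c' := by
        have := hc'; simp only [C, Finset.coe_filter, Finset.mem_filter, Set.mem_ofPred_eq] at this
        exact this.1.2
      have hee : e c = e c' := by
        by_contra hne
        apply h4 c hc
        rw [heq]
        exact h5 c' hc' _ (h1 c hc) hne
      rw [← hee] at heq
      rcases lt_trichotomy (k c) (k c') with hlt | hlt | hlt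
      · exfalso
        have hb := ray_back heq hlt.le
        have hk := h2 c hc
        have hF := h3 c' hc' (k c' - k c) (by omega) (by omega)
        rw [← hee, ← hb] at hF
        exact not_full_of_corner hcc hF
      · have hb := ray_back heq hlt.le
        rwa [hlt, Nat.sub_self, ray_zero] at hb
      · exfalso
        have hb := ray_back heq.symm hlt.le
        have hk := h2 c' hc'
        have hF := h3 c hc (k c - k c') (by omega) (by omega)
        rw [← hb] at hF
        exact not_full_of_corner hcc' hF
  have hgood : 4 ≤ (C.filter P).card := by omega
  obtain ⟨T, hT, hT4⟩ := Finset.exists_subset_card_eq hgood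
  refine ⟨fun t => (T.equivFinOfCardEq hT4).symm t, ?_, ?_⟩
  · exact Subtype.val_injective.comp (Equiv.injective _)
  · intro t
    exact (Finset.mem_filter.1 (hT ((T.equivFinOfCardEq hT4).symm t).2)).2
end

section
/- Let S be a board with b black cells and w white cells, and let B be its black-to-white matrix with respect to any bijections β : Fin b ≃ {black cells of S}, ω : Fin w ≃ {white cells of S}. Let v : Fin b → ℤ. If the system B · x = v admits a solution x with rational entries (i.e., the system obtained by viewing B and v over ℚ is solvable), then it admits a solution x with integer entries. -/
open scoped Matrix

/-- A constant Cech 1-cocycle on a space which is a retract of a simply connected, locally path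
connected space is trivial. -/
theorem cech_trivial {X M A ι : Type} [TopologicalSpace X] [TopologicalSpace M]
    [SimplyConnectedSpace M] [LocallyPathConnectedSpace M] [Nonempty X]
    [AddCommGroup A] [TopologicalSpace A] [DiscreteTopology A]
    (U : ι → Set X) (hU : ∀ i, IsOpen (U i)) (idx : X → ι) (hidx : ∀ x, x ∈ U (idx x))
    (τ : ι → ι → A)
    (hτ : ∀ i j k x, x ∈ U i → x ∈ U j → x ∈ U k → τ i j + τ j k = τ i k)
    (G : C(M, X)) (J : C(X, M)) (hGJ : ∀ x, G (J x) = x) :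
    ∃ a : ι → X → A, (∀ i, ContinuousOn (a i) (U i)) ∧
      ∀ i j x, x ∈ U i → x ∈ U j → a j x = a i x + τ i j := by
  let Z : FiberBundleCore ι X A :=
    { baseSet := U
      isOpen_baseSet := hU
      indexAt := idx
      mem_baseSet_at := hidx
      coordChange := fun i j _ v => v + τ i j
      coordChange_self := by
        intro i x hx v
        have := hτ i i i x hx hx hx
        simpa using this
      continuousOn_coordChange := by
        intro i j
        fun_prop
      coordChange_comp := by
        intro i j k x hx v
        rw [add_assoc, hτ i j k x hx.1.1 hx.1.2 hx.2] }
  have cov : IsCoveringMap (Bundle.TotalSpace.proj : Bundle.TotalSpace A Z.Fiber → X) :=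
    FiberBundle.isCoveringMap
  let x₀ : X := Classical.arbitrary X
  obtain ⟨F, ⟨-, hF⟩, -⟩ := cov.existsUnique_continuousMap_lifts G (J x₀)
    (⟨x₀, (0 : A)⟩ : Bundle.TotalSpace A Z.Fiber) (by simp [hGJ])
  have hproj : ∀ x, (F (J x)).proj = x := fun x => by
    have := congrFun hF (J x)
    simp only [Function.comp] at this
    rw [this, hGJ]
  refine ⟨fun i x => (Z.localTriv i (F (J x))).2, fun i => ?_, fun i j x hi hj => ?_⟩
  · refine continuous_snd.comp_continuousOn ?_
    refine (Z.localTriv i).continuousOn.comp (F.continuous.comp J.continuous).continuousOn ?_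
    intro x hx
    rw [Z.mem_localTriv_source]
    change (F (J x)).proj ∈ U i
    rw [hproj]; exact hx
  · simp only [FiberBundleCore.localTriv_apply]
    have hk : x ∈ U (idx (F (J x)).proj) := by rw [hproj]; exact hidx x
    have := hτ (idx (F (J x)).proj) i j x hk hi hj
    let v : A := (F (J x)).2
    change v + τ (idx (F (J x)).proj) j = v + τ (idx (F (J x)).proj) i + τ i j
    rw [← this, add_assoc]

/-- Local potentials on a 2 by 2 block. -/
theorem exists_block_potential {A : Type} [AddCommGroup A] (S : Finset Cell) (H V : Cell → A)
    (hcl : ∀ i j : ℤ, (i, j) ∈ S → (i + 1, j) ∈ S → (i, j + 1) ∈ S → (i + 1, j + 1) ∈ S →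
      H (i, j) + V (i + 1, j) = V (i, j) + H (i, j + 1)) (i j : ℤ) :
    ∃ P : Cell → A,
      ((i, j) ∈ S → (i + 1, j) ∈ S → P (i + 1, j) - P (i, j) = H (i, j)) ∧
      ((i, j) ∈ S → (i, j + 1) ∈ S → P (i, j + 1) - P (i, j) = V (i, j)) ∧
      ((i + 1, j) ∈ S → (i + 1, j + 1) ∈ S → P (i + 1, j + 1) - P (i + 1, j) = V (i + 1, j)) ∧
      ((i, j + 1) ∈ S → (i + 1, j + 1) ∈ S → P (i + 1, j + 1) - P (i, j + 1) = H (i, j + 1)) := by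
  have key : ∃ pa pb pc pd : A,
      ((i, j) ∈ S → (i + 1, j) ∈ S → pb - pa = H (i, j)) ∧
      ((i, j) ∈ S → (i, j + 1) ∈ S → pc - pa = V (i, j)) ∧
      ((i + 1, j) ∈ S → (i + 1, j + 1) ∈ S → pd - pb = V (i + 1, j)) ∧
      ((i, j + 1) ∈ S → (i + 1, j + 1) ∈ S → pd - pc = H (i, j + 1)) := by
    by_cases ha : (i, j) ∈ S
    · by_cases hb : (i + 1, j) ∈ S
      · refine ⟨0, H (i, j), V (i, j), H (i, j) + V (i + 1, j), by simp, by simp, by simp, ?_⟩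
        intro hc hd
        rw [hcl i j ha hb hc hd]; abel
      · exact ⟨0, H (i, j), V (i, j), V (i, j) + H (i, j + 1), by simp, by simp,
          fun h => absurd h hb, by simp⟩
    · exact ⟨0, -V (i + 1, j), -H (i, j + 1), 0, fun h => absurd h ha, fun h => absurd h ha,
        by simp, by simp⟩
  obtain ⟨pa, pb, pc, pd, h1, h2, h3, h4⟩ := key
  refine ⟨fun c => if c = (i, j) then pa else if c = (i + 1, j) then pb else
    if c = (i, j + 1) then pc else pd, ?_⟩
  simpa using ⟨h1, h2, h3, h4⟩

theorem exists_retraction (S : Finset Cell) (hS : IsBoard S) :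
    ∃ (G : C(EuclideanSpace ℝ (Fin 2), Region S)) (J : C(Region S, EuclideanSpace ℝ (Fin 2))),
      ∀ x, G (J x) = x := by
  obtain ⟨-, ⟨e⟩⟩ := hS
  let r : EuclideanSpace ℝ (Fin 2) → Metric.closedBall (0 : EuclideanSpace ℝ (Fin 2)) 1 :=
    fun x => ⟨(max 1 ‖x‖)⁻¹ • x, by
      have h : (0 : ℝ) < max 1 ‖x‖ := lt_of_lt_of_le one_pos (le_max_left _ _)
      rw [mem_closedBall_zero_iff, norm_smul, norm_inv, Real.norm_of_nonneg h.le,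
        inv_mul_le_one₀ h]
      exact le_max_right _ _⟩
  have hr : Continuous r := by
    refine Continuous.subtype_mk ?_ _
    have h1 : Continuous fun x : EuclideanSpace ℝ (Fin 2) => (max 1 ‖x‖)⁻¹ :=
      Continuous.inv₀ (by fun_prop) fun x => (lt_of_lt_of_le one_pos (le_max_left _ _)).ne'
    exact h1.smul continuous_id
  refine ⟨⟨fun x => e.symm (r x), e.symm.continuous.comp hr⟩,
    ⟨fun x => (e x : EuclideanSpace ℝ (Fin 2)), continuous_subtype_val.comp e.continuous⟩, ?_⟩
  intro x
  have : r (e x : EuclideanSpace ℝ (Fin 2)) = e x := by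
    apply Subtype.ext
    have h := (e x).2
    rw [mem_closedBall_zero_iff] at h
    simp [r, max_eq_left h]
  simp [this]

/-- Every closed discrete 1-form on a board is exact. -/
theorem exists_potential {A : Type} [AddCommGroup A] (S : Finset Cell) (hS : IsBoard S)
    (H V : Cell → A)
    (hcl : ∀ i j : ℤ, (i, j) ∈ S → (i + 1, j) ∈ S → (i, j + 1) ∈ S → (i + 1, j + 1) ∈ S →
      H (i, j) + V (i + 1, j) = V (i, j) + H (i, j + 1)) :
    ∃ h : Cell → A,
      (∀ i j : ℤ, (i, j) ∈ S → (i + 1, j) ∈ S → h (i + 1, j) - h (i, j) = H (i, j)) ∧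
      (∀ i j : ℤ, (i, j) ∈ S → (i, j + 1) ∈ S → h (i, j + 1) - h (i, j) = V (i, j)) := by
  choose P hP1 hP2 hP3 hP4 using exists_block_potential S H V hcl
  let τ : S → S → A := fun c d =>
    P (min c.1.1 d.1.1) (min c.1.2 d.1.2) d - P (min c.1.1 d.1.1) (min c.1.2 d.1.2) c
  -- the transition may be computed in any block
  have hτP : ∀ (i j : ℤ) (c d : S), (c.1.1 = i ∨ c.1.1 = i + 1) → (c.1.2 = j ∨ c.1.2 = j + 1) →
      (d.1.1 = i ∨ d.1.1 = i + 1) → (d.1.2 = j ∨ d.1.2 = j + 1) →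
      τ c d = P i j d - P i j c := by
    have key : ∀ (i j : ℤ) (c d : S), (c.1.1 = i ∨ c.1.1 = i + 1) → (c.1.2 = j ∨ c.1.2 = j + 1) →
      (d.1.1 = i ∨ d.1.1 = i + 1) → (d.1.2 = j ∨ d.1.2 = j + 1) →
      τ c d = P i j d - P i j c := by
      rintro i j ⟨⟨c1, c2⟩, hc⟩ ⟨⟨d1, d2⟩, hd⟩ h1 h2 h3 h4
      simp only at h1 h2 h3 h4
      simp only [τ]
      rcases h1 with rfl | rfl <;> rcases h2 with rfl | rfl <;> rcases h3 with rfl | rfl <;>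
        rcases h4 with rfl | rfl <;> simp
      · have e1 := hP4 _ _ hc hd
        have e2 := hP1 _ _ hc hd
        rw [e1, e2]
      · have e1 := hP3 _ _ hc hd
        have e2 := hP2 _ _ hc hd
        rw [e1, e2]
      · have e1 := hP4 _ _ hd hc
        have e2 := hP1 _ _ hd hc
        rw [← neg_sub, e2, ← e1, neg_sub]
      · have e1 := hP3 _ _ hd hc
        have e2 := hP2 _ _ hd hc
        rw [← neg_sub, e2, ← e1, neg_sub]
    exact key
  let U : S → Set (Region S) := fun c => {x |
    (c.1.1 : ℝ) - 1 / 4 < x.1.1 ∧ x.1.1 < (c.1.1 : ℝ) + 5 / 4 ∧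
    (c.1.2 : ℝ) - 1 / 4 < x.1.2 ∧ x.1.2 < (c.1.2 : ℝ) + 5 / 4}
  have hU : ∀ c, IsOpen (U c) := by
    intro c
    refine IsOpen.and (isOpen_lt (by fun_prop) (by fun_prop)) (IsOpen.and
      (isOpen_lt (by fun_prop) (by fun_prop)) (IsOpen.and (isOpen_lt (by fun_prop) (by fun_prop))
      (isOpen_lt (by fun_prop) (by fun_prop))))
  have hsq : ∀ (c : S) (x : Region S), x.1 ∈ unitSquare c.1 → x ∈ U c := by
    intro c x hx
    simp only [unitSquare, Set.mem_prod, Set.mem_Icc] at hx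
    obtain ⟨⟨h1, h2⟩, h3, h4⟩ := hx
    exact ⟨by linarith, by linarith, by linarith, by linarith⟩
  have hex : ∀ x : Region S, ∃ c : S, x ∈ U c := by
    intro x
    have hx := x.2
    simp only [Region, Set.mem_iUnion] at hx
    obtain ⟨c, hc, hxc⟩ := hx
    exact ⟨⟨c, hc⟩, hsq ⟨c, hc⟩ x hxc⟩
  choose idx hidx using hex
  have hclose : ∀ (c d : S) (x : Region S), x ∈ U c → x ∈ U d →
      c.1.1 ≤ d.1.1 + 1 ∧ c.1.2 ≤ d.1.2 + 1 := by
    rintro c d x ⟨h1, h2, h3, h4⟩ ⟨k1, k2, k3, k4⟩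
    constructor
    · have : (c.1.1 : ℝ) < (d.1.1 + 2 : ℤ) := by push_cast; linarith
      have := Int.cast_lt.mp this
      omega
    · have : (c.1.2 : ℝ) < (d.1.2 + 2 : ℤ) := by push_cast; linarith
      have := Int.cast_lt.mp this
      omega
  obtain ⟨G, J, hGJ⟩ := exists_retraction S hS
  have hmem : ∀ c ∈ S, ∀ x ∈ unitSquare c, x ∈ Region S := by
    intro c hc x hx
    simp only [Region, Set.mem_iUnion]
    exact ⟨c, hc, hx⟩
  have : Nonempty (Region S) := ⟨G 0⟩
  let _ : TopologicalSpace A := ⊥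
  have : DiscreteTopology A := ⟨rfl⟩
  obtain ⟨a, ha, hag⟩ := cech_trivial U hU idx hidx τ (by
    intro c d e x hc hd he
    have := hclose c d x hc hd
    have := hclose d c x hd hc
    have := hclose c e x hc he
    have := hclose e c x he hc
    have := hclose d e x hd he
    have := hclose e d x he hd
    have key := hτP (min c.1.1 (min d.1.1 e.1.1)) (min c.1.2 (min d.1.2 e.1.2))
    rw [key c d (by omega) (by omega) (by omega) (by omega),
      key d e (by omega) (by omega) (by omega) (by omega),
      key c e (by omega) (by omega) (by omega) (by omega)]
    abel) G J hGJ
  -- the upper right corner of a cell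
  have hcorner : ∀ c : Cell, ((c.1 : ℝ) + 1, (c.2 : ℝ) + 1) ∈ unitSquare c := by
    intro c
    simp [unitSquare]
  have hconst : ∀ (c : S) (x y : Region S), x.1 ∈ unitSquare c.1 → y.1 ∈ unitSquare c.1 →
      a c x = a c y := by
    intro c x y hx hy
    have hpre : IsPreconnected (unitSquare c.1) := isPreconnected_Icc.prod isPreconnected_Icc
    have hcont : ContinuousOn (fun z : unitSquare c.1 => a c ⟨z.1, hmem c.1 c.2 z.1 z.2⟩)
        Set.univ := by
      refine (ha c).comp (f := fun z : unitSquare c.1 =>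
        (⟨z.1, hmem c.1 c.2 z.1 z.2⟩ : Region S)) ?_ ?_
      · exact (Continuous.subtype_mk continuous_subtype_val _).continuousOn
      · intro z _
        exact hsq c _ z.2
    have := isPreconnected_iff_preconnectedSpace.mp hpre
    exact isPreconnected_univ.constant hcont (x := ⟨x.1, hx⟩) (y := ⟨y.1, hy⟩)
      (Set.mem_univ _) (Set.mem_univ _)
  classical
  let h : Cell → A := fun c => if hc : c ∈ S then
    a ⟨c, hc⟩ ⟨_, hmem c hc _ (hcorner c)⟩ else 0
  have hstep : ∀ (c d : S) (x : ℝ × ℝ), x ∈ unitSquare c.1 → x ∈ unitSquare d.1 →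
      h d - h c = τ c d := by
    intro c d x hc hd
    have e1 := hag c d ⟨x, hmem c.1 c.2 x hc⟩ (hsq c _ hc) (hsq d _ hd)
    rw [hconst d _ ⟨_, hmem d.1 d.2 _ (hcorner d.1)⟩ hd (hcorner d.1),
      hconst c _ ⟨_, hmem c.1 c.2 _ (hcorner c.1)⟩ hc (hcorner c.1)] at e1
    simp only [h, dif_pos c.2, dif_pos d.2]
    rw [e1]; abel
  refine ⟨h, fun i j hc hd => ?_, fun i j hc hd => ?_⟩
  · have e := hstep ⟨_, hc⟩ ⟨_, hd⟩ ((i : ℝ) + 1, (j : ℝ) + 1) (by simp [unitSquare])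
      (by simp [unitSquare])
    rw [hτP i j ⟨_, hc⟩ ⟨_, hd⟩ (by simp) (by simp) (by simp) (by simp)] at e
    rw [← hP1 i j hc hd]; exact e
  · have e := hstep ⟨_, hc⟩ ⟨_, hd⟩ ((i : ℝ) + 1, (j : ℝ) + 1) (by simp [unitSquare])
      (by simp [unitSquare])
    rw [hτP i j ⟨_, hc⟩ ⟨_, hd⟩ (by simp) (by simp) (by simp) (by simp)] at e
    rw [← hP2 i j hc hd]; exact e


theorem mem_whiteCells_iff (S : Finset Cell) (i j : ℤ) :
    (i, j) ∈ whiteCells S ↔ (i, j) ∈ S ∧ ¬ Even (i + j) := by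
  simp [whiteCells, IsBlackCell]

theorem mem_blackCells_iff (S : Finset Cell) (i j : ℤ) :
    (i, j) ∈ blackCells S ↔ (i, j) ∈ S ∧ Even (i + j) := by
  simp [blackCells, IsBlackCell]

/-- Kernel elements modulo `N` of the signed system lift to the integers. -/
theorem exists_lift_signed (S : Finset Cell) (hS : IsBoard S) (N : ℕ) (y : Cell → ZMod N)
    (hy0 : ∀ c, c ∉ whiteCells S → y c = 0)
    (hy : ∀ i j : ℤ, (i, j) ∈ blackCells S →
      y (i + 1, j) + y (i - 1, j) - y (i, j + 1) - y (i, j - 1) = 0) :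
    ∃ z : Cell → ℤ, (∀ c, c ∉ whiteCells S → z c = 0) ∧ (∀ c, (z c : ZMod N) = y c) ∧
      ∀ i j : ℤ, (i, j) ∈ blackCells S →
        z (i + 1, j) + z (i - 1, j) - z (i, j + 1) - z (i, j - 1) = 0 := by
  obtain ⟨h, hH, hV⟩ := exists_potential S hS
    (fun c => if Even (c.1 + c.2) then y (c.1, c.2 + 1) else - y c)
    (fun c => if Even (c.1 + c.2) then y (c.1, c.2 + 1) else - y (c.1 - 1, c.2 + 1)) (by
      intro i j h1 h2 h3 h4
      have e1 : Even (i + 1 + j) ↔ ¬ Even (i + j) := by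
        rw [show i + 1 + j = i + j + 1 by ring, Int.even_add_one]
      have e2 : Even (i + (j + 1)) ↔ ¬ Even (i + j) := by
        rw [show i + (j + 1) = i + j + 1 by ring, Int.even_add_one]
      simp only [e1, e2]
      by_cases he : Even (i + j)
      · simp [he]
      · have := hy i (j + 1) ((mem_blackCells_iff _ _ _).2 ⟨h3, e2.2 he⟩)
        simp only [add_sub_cancel_right] at this
        simp only [he, if_false, not_false_eq_true, if_true]
        linear_combination this)
  simp only at hH hV
  choose s hs using ZMod.intCast_surjective (n := N)
  have hY0 : ∀ c, c ∉ whiteCells S → s (h c) - s (h c - y c) = 0 := by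
    intro c hc
    simp [hy0 c hc]
  refine ⟨fun c => s (h c) - s (h c - y c), hY0, fun c => by simp [hs], ?_⟩
  intro i j hb
  have hbe := hy i j hb
  obtain ⟨hbS, he⟩ := (mem_blackCells_iff _ _ _).1 hb
  have oE : ¬ Even (i + 1 + j) := by
    rw [show i + 1 + j = i + j + 1 by ring, Int.even_add_one]; simpa using he
  have oN : ¬ Even (i + (j + 1)) := by
    rw [show i + (j + 1) = i + j + 1 by ring, Int.even_add_one]; simpa using he
  have oW : ¬ Even (i - 1 + j) := by
    rw [show i - 1 + j = i + j - 1 by ring, Int.even_sub_one]; simpa using he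
  have oS : ¬ Even (i + (j - 1)) := by
    rw [show i + (j - 1) = i + j - 1 by ring, Int.even_sub_one]; simpa using he
  have kE : s (h (i + 1, j)) - s (h (i + 1, j) - y (i + 1, j)) =
      s (h (i, j) + y (i, j + 1)) - s (h (i, j) + y (i, j + 1) - y (i + 1, j)) := by
    by_cases hc : (i + 1, j) ∈ S
    · have := hH i j hbS hc
      rw [if_pos he] at this
      rw [show h (i + 1, j) = h (i, j) + y (i, j + 1) by linear_combination this]
    · have : y (i + 1, j) = 0 := hy0 _ fun hw => hc ((mem_whiteCells_iff _ _ _).1 hw).1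
      simp [this]
  have kN : s (h (i, j + 1)) - s (h (i, j + 1) - y (i, j + 1)) =
      s (h (i, j) + y (i, j + 1)) - s (h (i, j)) := by
    by_cases hc : (i, j + 1) ∈ S
    · have := hV i j hbS hc
      rw [if_pos he] at this
      rw [show h (i, j + 1) = h (i, j) + y (i, j + 1) by linear_combination this,
        add_sub_cancel_right]
    · have : y (i, j + 1) = 0 := hy0 _ fun hw => hc ((mem_whiteCells_iff _ _ _).1 hw).1
      simp [this]
  have kW : s (h (i - 1, j)) - s (h (i - 1, j) - y (i - 1, j)) =
      s (h (i, j) + y (i - 1, j)) - s (h (i, j)) := by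
    by_cases hc : (i - 1, j) ∈ S
    · have := hH (i - 1) j hc (by simpa using hbS)
      rw [if_neg oW, sub_add_cancel] at this
      rw [show h (i - 1, j) = h (i, j) + y (i - 1, j) by linear_combination - this,
        add_sub_cancel_right]
    · have : y (i - 1, j) = 0 := hy0 _ fun hw => hc ((mem_whiteCells_iff _ _ _).1 hw).1
      simp [this]
  have kS : s (h (i, j - 1)) - s (h (i, j - 1) - y (i, j - 1)) =
      s (h (i, j) + y (i - 1, j)) - s (h (i, j) + y (i, j + 1) - y (i + 1, j)) := by
    have e3 : h (i, j) + y (i, j + 1) - y (i + 1, j) =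
        h (i, j) + y (i - 1, j) - y (i, j - 1) := by linear_combination - hbe
    rw [e3]
    by_cases hc : (i, j - 1) ∈ S
    · have := hV i (j - 1) hc (by simpa using hbS)
      rw [if_neg oS, sub_add_cancel] at this
      rw [show h (i, j - 1) = h (i, j) + y (i - 1, j) by linear_combination - this]
    · have : y (i, j - 1) = 0 := hy0 _ fun hw => hc ((mem_whiteCells_iff _ _ _).1 hw).1
      simp [this]
  simp only
  rw [kE, kN, kW, kS]
  ring

/-- Kernel elements modulo `N` of the unsigned system lift to the integers. -/
theorem exists_lift (S : Finset Cell) (hS : IsBoard S) (N : ℕ) (x : Cell → ZMod N)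
    (hx0 : ∀ c, c ∉ whiteCells S → x c = 0)
    (hx : ∀ i j : ℤ, (i, j) ∈ blackCells S →
      x (i + 1, j) + x (i - 1, j) + x (i, j + 1) + x (i, j - 1) = 0) :
    ∃ z : Cell → ℤ, (∀ c, c ∉ whiteCells S → z c = 0) ∧ (∀ c, (z c : ZMod N) = x c) ∧
      ∀ i j : ℤ, (i, j) ∈ blackCells S →
        z (i + 1, j) + z (i - 1, j) + z (i, j + 1) + z (i, j - 1) = 0 := by
  have hev : ∀ i : ℤ, (Even (i + 1) ↔ ¬ Even i) ∧ (Even (i - 1) ↔ ¬ Even i) := by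
    intro i
    refine ⟨Int.even_add_one, ?_⟩
    rw [Int.even_sub_one]
  obtain ⟨z, hz0, hzx, hz⟩ := exists_lift_signed S hS N
    (fun c => if Even c.1 then x c else - x c)
    (fun c hc => by simp [hx0 c hc])
    (by
      intro i j hb
      have := hx i j hb
      simp only [(hev i).1, (hev i).2]
      by_cases he : Even i
      · simp only [he, not_true_eq_false, if_false, if_true]
        linear_combination - this
      · simp only [he, not_false_eq_true, if_false, if_true]
        linear_combination this)
  refine ⟨fun c => if Even c.1 then z c else - z c, fun c hc => by simp [hz0 c hc], ?_, ?_⟩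
  · intro c
    have := hzx c
    by_cases he : Even c.1 <;> simp_all
  · intro i j hb
    have := hz i j hb
    simp only [(hev i).1, (hev i).2]
    by_cases he : Even i
    · simp only [he, not_true_eq_false, if_false, if_true]
      linear_combination - this
    · simp only [he, not_false_eq_true, if_false, if_true]
      linear_combination this

/-- The matrix-vector product as a sum over the four neighbours. -/
theorem btwMatrix_mulVec_eq {S : Finset Cell} {b w : ℕ}
    (β : Fin b ≃ blackCells S) (ω : Fin w ≃ whiteCells S) (x : Fin w → ℤ) (X : Cell → ℤ)
    (hX0 : ∀ c, c ∉ whiteCells S → X c = 0) (hX : ∀ k, X (ω k) = x k) (k : Fin b) (i j : ℤ)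
    (hk : (β k : Cell) = (i, j)) :
    (btwMatrix β ω).mulVec x k = X (i + 1, j) + X (i - 1, j) + X (i, j + 1) + X (i, j - 1) := by
  have h1 : (btwMatrix β ω).mulVec x k =
      ∑ c ∈ whiteCells S, if Adjacent (i, j) c then X c else 0 := by
    rw [← Finset.sum_coe_sort (whiteCells S), ← Equiv.sum_comp ω]
    simp only [Matrix.mulVec, dotProduct, btwMatrix, hk, hX, ite_mul, one_mul, zero_mul]
  have h2 : ∀ c : Cell, (if Adjacent (i, j) c then X c else 0) =
      (if c = (i + 1, j) then X c else 0) + (if c = (i - 1, j) then X c else 0) +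
      (if c = (i, j + 1) then X c else 0) + (if c = (i, j - 1) then X c else 0) := by
    rintro ⟨p, q⟩
    simp only [Adjacent, Prod.mk_sub_mk, Prod.mk.injEq]
    split_ifs <;> first | omega | simp
  rw [h1, Finset.sum_congr rfl fun c _ => h2 c]
  simp only [Finset.sum_add_distrib, Finset.sum_ite_eq']
  have h3 : ∀ c : Cell, (if c ∈ whiteCells S then X c else 0) = X c := by
    intro c
    split_ifs with h
    · rfl
    · exact (hX0 c h).symm
  simp only [h3]

/-- **Corollary.** For the black-to-white matrix `B` of a board, if `B x = v`
has a rational solution (with `v` integral), then it has an integer solution. -/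
theorem btwMatrix_int_solution_of_rat_solution
    (S : Finset Cell) (hS : IsBoard S) (b w : ℕ)
    (β : Fin b ≃ blackCells S) (ω : Fin w ≃ whiteCells S) (v : Fin b → ℤ)
    (hrat : ∃ x : Fin w → ℚ,
      ((btwMatrix β ω).map (Int.cast : ℤ → ℚ)).mulVec x = fun i => (v i : ℚ)) :
    ∃ x : Fin w → ℤ, (btwMatrix β ω).mulVec x = v := by
  obtain ⟨x, hx⟩ := hrat
  let N : ℕ := ∏ k, (x k).den
  have hN : N ≠ 0 := Finset.prod_ne_zero_iff.2 fun k _ => (x k).den_nz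
  have hNq : (N : ℚ) ≠ 0 := by exact_mod_cast hN
  have hXe : ∀ k, ∃ a : ℤ, (a : ℚ) = N * x k := by
    intro k
    obtain ⟨m, hm⟩ : (x k).den ∣ N := Finset.dvd_prod_of_mem (fun k => (x k).den) (Finset.mem_univ k)
    refine ⟨(x k).num * m, ?_⟩
    rw [hm]
    push_cast
    rw [← Rat.mul_den_eq_num (x k)]
    ring
  choose X hX using hXe
  have hBX : ∀ k, (btwMatrix β ω).mulVec X k = N * v k := by
    intro k
    have h := congrFun hx k
    have : (((btwMatrix β ω).mulVec X k : ℤ) : ℚ) = ((N * v k : ℤ) : ℚ) := by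
      push_cast
      rw [← h]
      simp only [Matrix.mulVec, dotProduct, Matrix.map_apply, Int.cast_sum, Int.cast_mul, hX,
        Finset.mul_sum]
      exact Finset.sum_congr rfl fun l _ => by ring
    exact_mod_cast this
  classical
  let Y : Cell → ℤ := fun c => if hc : c ∈ whiteCells S then X (ω.symm ⟨c, hc⟩) else 0
  have hY0 : ∀ c, c ∉ whiteCells S → Y c = 0 := fun c hc => by simp [Y, hc]
  have hYX : ∀ k, Y (ω k) = X k := fun k => by simp [Y]
  obtain ⟨z, hz0, hzY, hz⟩ := exists_lift S hS N (fun c => (Y c : ZMod N))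
    (fun c hc => by simp [hY0 c hc]) (by
      intro i j hb
      have h1 := btwMatrix_mulVec_eq β ω X Y hY0 hYX (β.symm ⟨(i, j), hb⟩) i j (by simp)
      rw [hBX] at h1
      have h2 := congrArg (Int.cast : ℤ → ZMod N) h1
      push_cast at h2
      simp only [CharP.cast_eq_zero, zero_mul] at h2
      exact h2.symm)
  have hdvd : ∀ k, ∃ u : ℤ, X k - z (ω k) = N * u := by
    intro k
    have h1 : ((X k - z (ω k) : ℤ) : ZMod N) = 0 := by
      push_cast
      rw [hzY, hYX, sub_self]
    exact (ZMod.intCast_zmod_eq_zero_iff_dvd _ _).1 h1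
  choose u hu using hdvd
  refine ⟨u, funext fun k => ?_⟩
  have hzk : (btwMatrix β ω).mulVec (fun l => z (ω l)) k = 0 := by
    rw [btwMatrix_mulVec_eq β ω (fun l => z (ω l)) z hz0 (fun _ => rfl) k (β k).1.1 (β k).1.2 rfl]
    exact hz _ _ (β k).2
  have h3 : (fun l => X l) - (fun l => z (ω l)) = (N : ℤ) • u := by
    funext l
    simpa using hu l
  have h4 : (btwMatrix β ω).mulVec ((fun l => X l) - (fun l => z (ω l))) k = N * v k := by
    rw [Matrix.mulVec_sub, Pi.sub_apply, hzk, sub_zero]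
    exact hBX k
  rw [h3, Matrix.mulVec_smul, Pi.smul_apply, smul_eq_mul] at h4
  exact mul_left_cancel₀ (by exact_mod_cast hN) h4
end

section
/- Let S be a board with b black cells and w white cells, and let B be its black-to-white matrix with respect to any bijections β : Fin b ≃ {black cells of S}, ω : Fin w ≃ {white cells of S}. Then the cokernel ℤ^b / B(ℤ^w) of the ℤ-linear map x ↦ B · x from ℤ^w to ℤ^b is a free abelian group (a free ℤ-module). -/
open scoped Matrix

/-- Trivialisation of constant-transition cocycles on a simply connected space. -/
lemma exists_section_of_cocycle {X : Type} [TopologicalSpace X] [SimplyConnectedSpace X]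
    [LocallyPathConnectedSpace X] {M : Type} [AddCommGroup M] {ι : Type} (U : ι → Set X)
    (hU : ∀ i, IsOpen (U i)) (idx : X → ι) (hidx : ∀ x, x ∈ U (idx x)) (t : ι → ι → M)
    (t0 : ∀ i, t i i = 0)
    (tc : ∀ i j k, ∀ x ∈ U i ∩ U j ∩ U k, t i j + t j k = t i k) :
    ∃ s : ι → X → M,
      (∀ i (C : Set X), IsPreconnected C → C ⊆ U i → ∀ x ∈ C, ∀ y ∈ C, s i x = s i y) ∧
      ∀ i j, ∀ x ∈ U i ∩ U j, s j x = s i x + t i j := by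
  let : TopologicalSpace M := ⊥
  have : DiscreteTopology M := ⟨rfl⟩
  let Z : FiberBundleCore ι X M :=
    { baseSet := U
      isOpen_baseSet := hU
      indexAt := idx
      mem_baseSet_at := hidx
      coordChange := fun i j _ m => m + t i j
      coordChange_self := fun i x _ v => by simp [t0]
      continuousOn_coordChange := fun i j =>
        ((continuous_of_discreteTopology (f := fun m : M => m + t i j)).comp
          continuous_snd).continuousOn
      coordChange_comp := fun i j k x hx v => by
        rw [add_assoc, tc i j k x hx] }
  have cov : IsCoveringMap (Z.proj) := FiberBundle.isCoveringMap (F := M) (E := Z.Fiber)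
  obtain ⟨x₀⟩ : Nonempty X := inferInstance
  obtain ⟨F, ⟨-, hF⟩, -⟩ := cov.existsUnique_continuousMap_lifts (ContinuousMap.id X) x₀
    (⟨x₀, (0 : M)⟩ : Z.TotalSpace) rfl
  have hF' : ∀ x, (F x).1 = x := fun x => congrFun hF x
  refine ⟨fun i x => (Z.localTriv i (F x)).2, ?_, ?_⟩
  · intro i C hC hCU x hx y hy
    have hc : ContinuousOn (fun x => (Z.localTriv i (F x)).2) C := by
      apply continuous_snd.comp_continuousOn
      apply (Z.localTriv i).continuousOn_toFun.comp F.continuous.continuousOn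
      intro z hz
      change (F z).1 ∈ U i
      rw [hF']
      exact hCU hz
    exact hC.constant hc hx hy
  · intro i j x hx
    have hm : ∀ m : M, m + t (idx (F x).1) j = m + t (idx (F x).1) i + t i j := by
      intro m
      rw [add_assoc, tc _ i j x ⟨⟨?_, hx.1⟩, hx.2⟩]
      rw [hF']
      exact hidx x
    exact hm (F x).2

/-- Signed sum along a horizontal step. -/
def stepH {M : Type} [AddCommGroup M] (d : Cell → M) (a b y : ℤ) : M :=
  if b = a + 1 then d (a, y) else if a = b + 1 then - d (b, y) else 0

/-- Signed sum along a vertical step. -/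
def stepV {M : Type} [AddCommGroup M] (d : Cell → M) (a b x : ℤ) : M :=
  if b = a + 1 then d (x, a) else if a = b + 1 then - d (x, b) else 0

/-- Transition between two corners of a common cell. -/
def cornerDiff {M : Type} [AddCommGroup M] (dH dV : Cell → M) (v w : Cell) : M :=
  stepH dH v.1 w.1 v.2 + stepV dV v.2 w.2 w.1

lemma cornerDiff_eq {M : Type} [AddCommGroup M] (dH dV : Cell → M) (x y : ℤ)
    (hc : dH (x, y) + dV (x + 1, y) = dV (x, y) + dH (x, y + 1)) (v w : Cell)
    (hv1 : v.1 = x ∨ v.1 = x + 1) (hv2 : v.2 = y ∨ v.2 = y + 1)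
    (hw1 : w.1 = x ∨ w.1 = x + 1) (hw2 : w.2 = y ∨ w.2 = y + 1) :
    cornerDiff dH dV v w = cornerDiff dH dV (x, y) w - cornerDiff dH dV (x, y) v := by
  obtain ⟨v1, v2⟩ := v
  obtain ⟨w1, w2⟩ := w
  simp only at hv1 hv2 hw1 hw2
  have hc' : dV (x + 1, y) = dV (x, y) + dH (x, y + 1) - dH (x, y) := by
    rw [← hc]; abel
  clear hc
  have e1 : ∀ z : ℤ, ¬ (z = z + 1 + 1) := fun z => by omega
  rcases hv1 with rfl | rfl <;> rcases hv2 with rfl | rfl <;> rcases hw1 with rfl | rfl <;>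
    rcases hw2 with rfl | rfl <;> simp [cornerDiff, stepH, stepV, e1] <;>
    (try simp only [hc']) <;> abel1

lemma corner_of_near (c v : ℤ) (r : ℝ) (h1 : (c : ℝ) ≤ r) (h2 : r ≤ c + 1)
    (h3 : (v : ℝ) - 1 < r) (h4 : r < v + 1) : v = c ∨ v = c + 1 := by
  have a : v < c + 2 := by
    have : (v : ℝ) < ((c + 2 : ℤ) : ℝ) := by push_cast; linarith
    exact_mod_cast this
  have b : c < v + 1 := by
    have : (c : ℝ) < ((v + 1 : ℤ) : ℝ) := by push_cast; linarith
    exact_mod_cast this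
  omega

/-- Combinatorial vanishing of the first cohomology of a board, any coefficients. -/
lemma board_cocycle {S : Finset Cell} (hS : IsBoard S) {M : Type} [AddCommGroup M]
    (dH dV : Cell → M)
    (hc : ∀ x y : ℤ, (x, y) ∈ S → dH (x, y) + dV (x + 1, y) = dV (x, y) + dH (x, y + 1)) :
    ∃ h : Cell → M, ∀ x y : ℤ, (x, y) ∈ S →
      h (x + 1, y) = h (x, y) + dH (x, y) ∧ h (x, y + 1) = h (x, y) + dV (x, y) ∧
      h (x + 1, y + 1) = h (x + 1, y) + dV (x + 1, y) ∧
      h (x + 1, y + 1) = h (x, y + 1) + dH (x, y + 1) := by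
  obtain ⟨-, ⟨e⟩⟩ := hS
  have hconv : Convex ℝ (Metric.closedBall (0 : EuclideanSpace ℝ (Fin 2)) 1) :=
    convex_closedBall _ _
  have : LocallyPathConnectedSpace (Metric.closedBall (0 : EuclideanSpace ℝ (Fin 2)) 1) :=
    hconv.locallyPathConnectedSpace
  have : ContractibleSpace (Metric.closedBall (0 : EuclideanSpace ℝ (Fin 2)) 1) :=
    hconv.contractibleSpace ⟨0, by simp⟩
  have : ContractibleSpace (Region S) := e.contractibleSpace
  have : LocallyPathConnectedSpace (Region S) := e.isOpenEmbedding.locallyPathConnectedSpace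
  let O : Cell → Set (ℝ × ℝ) := fun v =>
    Set.Ioo ((v.1 : ℝ) - 1) (v.1 + 1) ×ˢ Set.Ioo ((v.2 : ℝ) - 1) (v.2 + 1)
  let U : Cell → Set (Region S) := fun v => Subtype.val ⁻¹' O v
  have key : ∀ c v : Cell, ∀ r : ℝ × ℝ, r ∈ unitSquare c → r ∈ O v →
      (v.1 = c.1 ∨ v.1 = c.1 + 1) ∧ (v.2 = c.2 ∨ v.2 = c.2 + 1) := by
    intro c v r h1 h2
    exact ⟨corner_of_near _ _ _ h1.1.1 h1.1.2 h2.1.1 h2.1.2,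
      corner_of_near _ _ _ h1.2.1 h1.2.2 h2.2.1 h2.2.2⟩
  obtain ⟨s, hs1, hs2⟩ := exists_section_of_cocycle U
    (fun v => ((isOpen_Ioo.prod isOpen_Ioo).preimage continuous_subtype_val))
    (fun x => (⌊x.1.1⌋, ⌊x.1.2⌋))
    (fun x => by
      refine ⟨⟨?_, ?_⟩, ⟨?_, ?_⟩⟩
      · have := Int.floor_le x.1.1
        simp only; linarith
      · exact Int.lt_floor_add_one x.1.1
      · have := Int.floor_le x.1.2
        simp only; linarith
      · exact Int.lt_floor_add_one x.1.2)
    (cornerDiff dH dV) (fun i => by simp [cornerDiff, stepH, stepV])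
    (fun i j k x hx => by
      obtain ⟨⟨hi, hj⟩, hk⟩ := hx
      obtain ⟨c, hcS, hxc⟩ := Set.mem_iUnion₂.1 x.2
      have h1 := key c i _ hxc hi
      have h2 := key c j _ hxc hj
      have h3 := key c k _ hxc hk
      have hcc := hc c.1 c.2 hcS
      rw [cornerDiff_eq dH dV c.1 c.2 hcc i j h1.1 h1.2 h2.1 h2.2,
        cornerDiff_eq dH dV c.1 c.2 hcc j k h2.1 h2.2 h3.1 h3.2,
        cornerDiff_eq dH dV c.1 c.2 hcc i k h1.1 h1.2 h3.1 h3.2]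
      abel)
  classical
  let pt : Cell → ℝ × ℝ := fun v => ((v.1 : ℝ), (v.2 : ℝ))
  refine ⟨fun v => if hv : pt v ∈ Region S then s v ⟨pt v, hv⟩ else 0, ?_⟩
  intro x y hxy
  have hsub : unitSquare (x, y) ⊆ Region S := fun r hr => Set.mem_iUnion₂.2 ⟨(x, y), hxy, hr⟩
  let ctr : ℝ × ℝ := ((x : ℝ) + 1 / 2, (y : ℝ) + 1 / 2)
  have hctr : ctr ∈ unitSquare (x, y) := by
    refine ⟨⟨?_, ?_⟩, ⟨?_, ?_⟩⟩ <;> simp only [ctr] <;> linarith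
  -- each corner is linked to the centre
  have link : ∀ v : Cell, (v.1 = x ∨ v.1 = x + 1) → (v.2 = y ∨ v.2 = y + 1) →
      ctr ∈ O v ∧
      (if hv : pt v ∈ Region S then s v ⟨pt v, hv⟩ else 0) = s v ⟨ctr, hsub hctr⟩ := by
    intro v h1 h2
    have hptO : pt v ∈ O v := by
      refine ⟨⟨?_, ?_⟩, ⟨?_, ?_⟩⟩ <;> simp only [pt] <;> linarith
    have hv1 : (v.1 : ℝ) = x ∨ (v.1 : ℝ) = x + 1 := by exact_mod_cast h1
    have hv2 : (v.2 : ℝ) = y ∨ (v.2 : ℝ) = y + 1 := by exact_mod_cast h2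
    have hptS : pt v ∈ unitSquare (x, y) := by
      refine ⟨⟨?_, ?_⟩, ⟨?_, ?_⟩⟩ <;> simp only [pt] <;>
        rcases hv1 with a | a <;> rcases hv2 with b | b <;> linarith
    have hctrO : ctr ∈ O v := by
      refine ⟨⟨?_, ?_⟩, ⟨?_, ?_⟩⟩ <;> simp only [ctr] <;>
        rcases hv1 with a | a <;> rcases hv2 with b | b <;> linarith
    refine ⟨hctrO, ?_⟩
    rw [dif_pos (hsub hptS)]
    refine hs1 v (Subtype.val ⁻¹' (unitSquare (x, y) ∩ O v)) ?_ ?_ _ ⟨hptS, hptO⟩ _ ⟨hctr, hctrO⟩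
    · rw [← Topology.IsInducing.subtypeVal.isPreconnected_image, Subtype.image_preimage_coe,
        Set.inter_eq_right.2 (Set.inter_subset_left.trans hsub)]
      apply Convex.isPreconnected
      exact ((convex_Icc _ _).prod (convex_Icc _ _)).inter
        ((convex_Ioo _ _).prod (convex_Ioo _ _))
    · exact fun z hz => hz.2
  have step : ∀ v w : Cell, (v.1 = x ∨ v.1 = x + 1) → (v.2 = y ∨ v.2 = y + 1) →
      (w.1 = x ∨ w.1 = x + 1) → (w.2 = y ∨ w.2 = y + 1) →
      (if hv : pt w ∈ Region S then s w ⟨pt w, hv⟩ else 0) =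
      (if hv : pt v ∈ Region S then s v ⟨pt v, hv⟩ else 0) + cornerDiff dH dV v w := by
    intro v w h1 h2 h3 h4
    rw [(link v h1 h2).2, (link w h3 h4).2]
    exact hs2 v w _ ⟨(link v h1 h2).1, (link w h3 h4).1⟩
  refine ⟨?_, ?_, ?_, ?_⟩
  · simpa [cornerDiff, stepH, stepV] using step (x, y) (x + 1, y) (by simp) (by simp) (by simp) (by simp)
  · simpa [cornerDiff, stepH, stepV] using step (x, y) (x, y + 1) (by simp) (by simp) (by simp) (by simp)
  · simpa [cornerDiff, stepH, stepV] using
      step (x + 1, y) (x + 1, y + 1) (by simp) (by simp) (by simp) (by simp)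
  · simpa [cornerDiff, stepH, stepV] using
      step (x, y + 1) (x + 1, y + 1) (by simp) (by simp) (by simp) (by simp)

/-- Solutions of the homogeneous system lift along surjections of abelian groups. -/
lemma lift_solution {S : Finset Cell} (hS : IsBoard S) {M N : Type} [AddCommGroup M]
    [AddCommGroup N] (π : N →+ M) (hπ : Function.Surjective π) (f : Cell → M)
    (f0 : ∀ c, c ∉ blackCells S → f c = 0)
    (hf : ∀ x y : ℤ, (x, y) ∈ whiteCells S →
      f (x + 1, y) + f (x - 1, y) + f (x, y + 1) + f (x, y - 1) = 0) :
    ∃ g : Cell → N, (∀ c, c ∉ blackCells S → g c = 0) ∧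
      (∀ x y : ℤ, (x, y) ∈ whiteCells S →
        g (x + 1, y) + g (x - 1, y) + g (x, y + 1) + g (x, y - 1) = 0) ∧
      ∀ c, π (g c) = f c := by
  classical
  let G : Cell → M := fun c => if Even c.1 then f c else - f c
  have G0 : ∀ c, c ∉ blackCells S → G c = 0 := fun c hc => by simp [G, f0 c hc]
  have hG : ∀ x y : ℤ, (x, y) ∈ whiteCells S →
      G (x, y - 1) - G (x + 1, y) = G (x - 1, y) - G (x, y + 1) := by
    intro x y hw
    have h := hf x y hw
    rw [← sub_eq_zero]
    by_cases hx : Even x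
    · have h1 : ¬ Even (x + 1) := by rw [Int.even_add_one]; simpa using hx
      have h2 : ¬ Even (x - 1) := by rw [Int.even_sub_one]; simpa using hx
      simp only [G, hx, h1, h2, if_true, if_false]
      rw [← h]; abel
    · have h1 : Even (x + 1) := by rw [Int.even_add_one]; simpa using hx
      have h2 : Even (x - 1) := by rw [Int.even_sub_one]; simpa using hx
      simp only [G, hx, h1, h2, if_true, if_false]
      rw [← neg_eq_zero, ← h]; abel
  let dH : Cell → M := fun c => if Even (c.1 + c.2) then - G c else G (c.1, c.2 - 1)
  let dV : Cell → M := fun c => if Even (c.1 + c.2) then - G c else G (c.1 - 1, c.2)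
  have par : ∀ x y : ℤ, (Even (x + y) → ¬ Even (x + 1 + y) ∧ ¬ Even (x + (y + 1))) ∧
      (¬ Even (x + y) → Even (x + 1 + y) ∧ Even (x + (y + 1)) ∧ Even (x - 1 + y) ∧
        Even (x + (y - 1))) := by
    intro x y
    simp only [Int.even_iff]
    omega
  obtain ⟨h, hh⟩ := board_cocycle hS dH dV (by
    intro x y hxy
    by_cases he : Even (x + y)
    · have := (par x y).1 he
      simp [dH, dV, he, this]
    · have := (par x y).2 he
      have hw : (x, y) ∈ whiteCells S := Finset.mem_filter.2 ⟨hxy, he⟩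
      have hg := hG x y hw
      simp only [dH, dV, he, this, if_true, if_false]
      rw [← sub_eq_add_neg, ← sub_eq_add_neg]; exact hg)
  have hB : ∀ x y : ℤ, (x, y) ∈ blackCells S →
      h (x + 1, y) = h (x, y) - G (x, y) ∧ h (x, y + 1) = h (x + 1, y) ∧
      h (x + 1, y + 1) = h (x, y) := by
    intro x y hc
    have hc' : (x, y) ∈ S ∧ Even (x + y) := by simpa [blackCells, IsBlackCell] using hc
    obtain ⟨h1, h2, h3, h4⟩ := hh x y hc'.1
    have hp := (par x y).1 hc'.2
    simp only [dH, dV, hc'.2, hp, if_true, if_false, add_sub_cancel_right] at h1 h2 h3 h4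
    refine ⟨by rw [h1]; abel, by rw [h2, h1], by rw [h3, h1]; abel⟩
  have hW : ∀ x y : ℤ, (x, y) ∈ whiteCells S →
      h (x + 1, y) = h (x, y) + G (x, y - 1) ∧ h (x, y + 1) = h (x, y) + G (x - 1, y) ∧
      h (x + 1, y + 1) = h (x + 1, y) - G (x + 1, y) ∧
      h (x + 1, y + 1) = h (x, y + 1) - G (x, y + 1) := by
    intro x y hc
    have hc' : (x, y) ∈ S ∧ ¬ Even (x + y) := by
      simpa [whiteCells, IsBlackCell] using hc
    obtain ⟨h1, h2, h3, h4⟩ := hh x y hc'.1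
    have hp := (par x y).2 hc'.2
    simp only [dH, dV, hc'.2, hp, if_true, if_false, ← sub_eq_add_neg] at h1 h2 h3 h4
    exact ⟨h1, h2, h3, h4⟩
  obtain ⟨σ, hσ⟩ := hπ.hasRightInverse
  let k : Cell → N := fun v => σ (h v)
  let G' : Cell → N := fun c => if c ∈ blackCells S then k c - k (c.1 + 1, c.2) else 0
  have hG' : ∀ x y : ℤ, (x, y) ∈ whiteCells S →
      G' (x, y - 1) = k (x + 1, y) - k (x, y) ∧ G' (x - 1, y) = k (x, y + 1) - k (x, y) ∧
      G' (x + 1, y) = k (x + 1, y) - k (x + 1, y + 1) ∧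
      G' (x, y + 1) = k (x, y + 1) - k (x + 1, y + 1) := by
    intro x y hw
    obtain ⟨w1, w2, w3, w4⟩ := hW x y hw
    refine ⟨?_, ?_, ?_, ?_⟩
    · by_cases hc : (x, y - 1) ∈ blackCells S
      · obtain ⟨-, b2, b3⟩ := hB _ _ hc
        simp only [sub_add_cancel] at b2 b3
        simp only [G', hc, if_true, k, b2, b3]
      · simp [G', hc, k, w1, G0 _ hc]
    · by_cases hc : (x - 1, y) ∈ blackCells S
      · obtain ⟨-, b2, b3⟩ := hB _ _ hc
        simp only [sub_add_cancel] at b2 b3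
        simp only [G', hc, if_true, k, b3, sub_add_cancel]
      · simp [G', hc, k, w2, G0 _ hc]
    · by_cases hc : (x + 1, y) ∈ blackCells S
      · obtain ⟨-, b2, b3⟩ := hB _ _ hc
        simp only [G', hc, if_true, k, b2]
      · simp [G', hc, k, w3, G0 _ hc]
    · by_cases hc : (x, y + 1) ∈ blackCells S
      · simp only [G', hc, if_true, k]
      · simp [G', hc, k, w4, G0 _ hc]
  refine ⟨fun c => if Even c.1 then G' c else - G' c, ?_, ?_, ?_⟩
  · intro c hc
    simp [G', hc]
  · intro x y hw
    obtain ⟨w1, w2, w3, w4⟩ := hG' x y hw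
    by_cases hx : Even x
    · have h1 : ¬ Even (x + 1) := by rw [Int.even_add_one]; simpa using hx
      have h2 : ¬ Even (x - 1) := by rw [Int.even_sub_one]; simpa using hx
      simp only [hx, h1, h2, if_true, if_false, w1, w2, w3, w4]
      abel
    · have h1 : Even (x + 1) := by rw [Int.even_add_one]; simpa using hx
      have h2 : Even (x - 1) := by rw [Int.even_sub_one]; simpa using hx
      simp only [hx, h1, h2, if_true, if_false, w1, w2, w3, w4]
      abel
  · rintro ⟨x, y⟩
    have hGG : π (G' (x, y)) = G (x, y) := by
      by_cases hc : (x, y) ∈ blackCells S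
      · obtain ⟨b1, -, -⟩ := hB _ _ hc
        simp only [G', hc, if_true, map_sub, k, hσ _, b1]
        abel
      · simp [G', hc, G0 _ hc]
    by_cases hx : Even x
    · simp [hx, hGG, G]
    · simp [hx, hGG, G]

/-- Column sums of the black-to-white matrix. -/
lemma column_sum {S : Finset Cell} {b w : ℕ} (β : Fin b ≃ blackCells S)
    (ω : Fin w ≃ whiteCells S) {N : Type} [AddCommGroup N] (g : Cell → N)
    (g0 : ∀ c, c ∉ blackCells S → g c = 0) (j : Fin w) (x y : ℤ) (hj : (ω j : Cell) = (x, y)) :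
    ∑ i, btwMatrix β ω i j • g (β i) =
      g (x + 1, y) + g (x - 1, y) + g (x, y + 1) + g (x, y - 1) := by
  classical
  have e1 : ∑ i, btwMatrix β ω i j • g (β i) =
      ∑ c : blackCells S, if Adjacent (c : Cell) (x, y) then g c else 0 := by
    rw [← Equiv.sum_comp β]
    refine Finset.sum_congr rfl fun i _ => ?_
    simp [btwMatrix, hj, ite_smul]
  have e2 : ∑ c : blackCells S, (if Adjacent (c : Cell) (x, y) then g c else 0) =
      ∑ c ∈ blackCells S, if Adjacent c (x, y) then g c else 0 :=
    Finset.sum_coe_sort (blackCells S) (fun c => if Adjacent c (x, y) then g c else 0)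
  have e3 : ∑ c ∈ ({(x + 1, y), (x - 1, y), (x, y + 1), (x, y - 1)} : Finset Cell), g c =
      g (x + 1, y) + g (x - 1, y) + g (x, y + 1) + g (x, y - 1) := by
    rw [Finset.sum_insert, Finset.sum_insert, Finset.sum_insert, Finset.sum_singleton]
    · abel
    all_goals simp only [Finset.mem_insert, Finset.mem_singleton, Prod.mk.injEq]; omega
  have hadj : ∀ c : Cell, Adjacent c (x, y) ↔
      c ∈ ({(x + 1, y), (x - 1, y), (x, y + 1), (x, y - 1)} : Finset Cell) := by
    rintro ⟨u, v⟩
    simp only [Adjacent, Finset.mem_insert, Finset.mem_singleton, Prod.mk.injEq, Prod.mk_sub_mk]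
    omega
  rw [e1, e2, ← e3, ← Finset.sum_filter]
  apply Finset.sum_subset
  · intro c hc
    exact (hadj c).1 (Finset.mem_filter.1 hc).2
  · intro c hc hn
    apply g0
    intro hb
    exact hn (Finset.mem_filter.2 ⟨hb, (hadj c).2 hc⟩)

/-- **Corollary.** The cokernel `ℤ^b / B(ℤ^w)` of the black-to-white matrix of a
board is a free abelian group. -/
theorem btwMatrix_cokernel_free
    (S : Finset Cell) (hS : IsBoard S) (b w : ℕ)
    (β : Fin b ≃ blackCells S) (ω : Fin w ≃ whiteCells S) :
    Module.Free ℤ ((Fin b → ℤ) ⧸ LinearMap.range (Matrix.mulVecLin (btwMatrix β ω))) := by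

  classical
  set B := btwMatrix β ω with hBdef
  set R := LinearMap.range (Matrix.mulVecLin B) with hR
  let f : Cell → ((Fin b → ℤ) ⧸ R) := fun c =>
    if hc : c ∈ blackCells S then R.mkQ (Pi.single (β.symm ⟨c, hc⟩) 1) else 0
  have f0 : ∀ c, c ∉ blackCells S → f c = 0 := fun c hc => by simp only [f, hc, dif_neg,
    not_false_eq_true]
  have fβ : ∀ i, f (β i) = R.mkQ (Pi.single i 1) := by
    intro i
    have : ((β i : Cell)) ∈ blackCells S := (β i).2
    simp only [f, this, dif_pos, Subtype.coe_eta, Equiv.symm_apply_apply]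
  obtain ⟨g, g0, hg, hgf⟩ := lift_solution hS R.mkQ.toAddMonoidHom R.mkQ_surjective f f0 (by
    intro x y hw
    obtain ⟨j, hj⟩ := ω.surjective ⟨(x, y), hw⟩
    have hj' : (ω j : Cell) = (x, y) := by rw [hj]
    rw [← column_sum β ω f f0 j x y hj']
    simp only [fβ, ← map_zsmul, ← map_sum]
    rw [Submodule.mkQ_apply, Submodule.Quotient.mk_eq_zero]
    refine ⟨Pi.single j 1, ?_⟩
    ext i
    simp [Finset.sum_apply, Pi.single_apply, hBdef])
  let L : (Fin b → ℤ) →ₗ[ℤ] (Fin b → ℤ) := Fintype.linearCombination ℤ (fun i => g (β i))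
  have hL : R ≤ LinearMap.ker L := by
    rw [hR, LinearMap.range_le_ker_iff]
    apply LinearMap.pi_ext'
    intro j
    apply LinearMap.ext_ring
    have hw := (ω j).2
    have hcol := column_sum β ω g g0 j (ω j).1.1 (ω j).1.2 rfl
    rw [hg _ _ hw] at hcol
    simp only [LinearMap.comp_apply, LinearMap.zero_apply, L, Fintype.linearCombination_apply,
      LinearMap.coe_single, Matrix.mulVecLin_apply, Matrix.mulVec_single_one]
    exact hcol
  let s : ((Fin b → ℤ) ⧸ R) →ₗ[ℤ] (Fin b → ℤ) := R.liftQ L hL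
  have hs : R.mkQ ∘ₗ s = LinearMap.id := by
    apply Submodule.linearMap_qext
    apply LinearMap.pi_ext'
    intro i
    apply LinearMap.ext_ring
    have h1 : s (R.mkQ (Pi.single i 1)) = g (β i) := by
      simp [s, L, Fintype.linearCombination_apply, Pi.single_apply]
    have h2 : R.mkQ (g (β i)) = R.mkQ (Pi.single i 1) := (hgf (β i)).trans (fβ i)
    simp only [LinearMap.comp_apply, LinearMap.coe_single, LinearMap.id_apply]
    rw [h1, h2]
  have hinj : Function.Injective s := by
    intro u v huv
    have := congrArg R.mkQ huv
    rwa [← LinearMap.comp_apply, ← LinearMap.comp_apply, hs] at this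
  exact Module.Free.of_equiv (LinearEquiv.ofInjective s hinj).symm
end

section
/- Let S be a board with b black cells and w white cells, and let B be its black-to-white matrix with respect to any bijections β : Fin b ≃ {black cells of S}, ω : Fin w ≃ {white cells of S}. Then for every prime number p, the rank of B viewed as a matrix over ℚ (via the inclusion ℤ → ℚ) equals the rank of B viewed as a matrix over the field ℤ/pℤ (via reduction mod p). -/
open scoped Matrix

/-- Circulations mod `p` lift to integral circulations. -/
lemma circ_lift {E N : Type*} (p : ℕ) (hp : p ≠ 0) (hd tl : E → N) (f : E →₀ ZMod p)
    (h : Finsupp.mapDomain hd f = Finsupp.mapDomain tl f) :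
    ∃ f' : E →₀ ℤ, Finsupp.mapDomain hd f' = Finsupp.mapDomain tl f' ∧
      ∀ e, (f' e : ZMod p) = f e := by
  classical
  -- the boundary map
  let bd : (E →₀ ℤ) →+ (N →₀ ℤ) :=
    Finsupp.mapDomain.addMonoidHom hd - Finsupp.mapDomain.addMonoidHom tl
  have hbd : ∀ f, bd f = Finsupp.mapDomain hd f - Finsupp.mapDomain tl f := fun f => rfl
  let r : N → N → Prop := fun n m => ∃ e, tl e = n ∧ hd e = m
  -- connected nodes are equivalent modulo the image
  have h1 : ∀ n m, Relation.EqvGen r n m → ∀ a : ℤ,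
      Finsupp.single n a - Finsupp.single m a ∈ bd.range := by
    intro n m hnm a
    induction hnm with
    | rel x y hxy =>
      obtain ⟨e, rfl, rfl⟩ := hxy
      refine ⟨Finsupp.single e (-a), ?_⟩
      rw [hbd, Finsupp.mapDomain_single, Finsupp.mapDomain_single]
      simp [sub_eq_add_neg, add_comm]
    | refl x => simp
    | symm x y _ ih => 
      have := bd.range.neg_mem ih
      simpa using this
    | trans x y z _ _ ih1 ih2 =>
      have := bd.range.add_mem ih1 ih2
      simpa using this
  let π : N → Quot r := Quot.mk r
  let σ : Quot r → N := Quot.out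
  have h2 : ∀ d : N →₀ ℤ, d - Finsupp.mapDomain (σ ∘ π) d ∈ bd.range := by
    intro d
    induction d using Finsupp.induction_linear with
    | zero => simp
    | add x y hx hy =>
      have := bd.range.add_mem hx hy
      rw [Finsupp.mapDomain_add]
      convert this using 1
      abel
    | single n a =>
      rw [Finsupp.mapDomain_single]
      apply h1
      apply Quot.eqvGen_exact
      exact (Quot.out_eq (Quot.mk r n)).symm
  have h3 : ∀ d : N →₀ ℤ, Finsupp.mapDomain π d = 0 → d ∈ bd.range := by
    intro d hd0
    have := h2 d
    rwa [Finsupp.mapDomain_comp, hd0, Finsupp.mapDomain_zero, sub_zero] at this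
  have h4 : ∀ k, Finsupp.mapDomain π (bd k) = 0 := by
    intro k
    have : π ∘ hd = π ∘ tl := by
      funext e
      exact (Quot.sound ⟨e, rfl, rfl⟩).symm
    have h5 : Finsupp.mapDomain π (bd k) = Finsupp.mapDomain π (Finsupp.mapDomain hd k)
        - Finsupp.mapDomain π (Finsupp.mapDomain tl k) := by
      rw [hbd]
      exact map_sub (Finsupp.mapDomain.addMonoidHom π) _ _
    rw [h5, ← Finsupp.mapDomain_comp, ← Finsupp.mapDomain_comp, this, sub_self]
  -- an arbitrary lift
  have hsurj : ∃ f0 : E →₀ ℤ, ∀ e, (f0 e : ZMod p) = f e := by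
    choose s hs using ZMod.intCast_surjective (n := p)
    refine ⟨Finsupp.onFinset f.support (fun e => if f e = 0 then 0 else s (f e)) ?_, ?_⟩
    · intro e he
      simp at he ⊢
      exact he.1
    · intro e
      simp only [Finsupp.onFinset_apply]
      split_ifs with h0
      · simp [h0]
      · exact hs _
  obtain ⟨f0, hf0⟩ := hsurj
  have hf0' : f0.mapRange (Int.castAddHom (ZMod p)) (map_zero _) = f := by
    ext e; simp [hf0]
  have h6 : ∀ n, (p : ℤ) ∣ bd f0 n := by
    intro n
    rw [← ZMod.intCast_zmod_eq_zero_iff_dvd, hbd]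
    have e1 := Finsupp.mapDomain_mapRange hd f0 (Int.castAddHom (ZMod p)) (map_zero _) (map_add _)
    have e2 := Finsupp.mapDomain_mapRange tl f0 (Int.castAddHom (ZMod p)) (map_zero _) (map_add _)
    rw [hf0'] at e1 e2
    rw [e1, e2] at h
    have := DFunLike.congr_fun h n
    simp only [Finsupp.mapRange_apply, Int.coe_castAddHom] at this
    simp [this]
  choose d0 hd0 using h6
  have hp0 : (p : ℤ) ≠ 0 := by exact_mod_cast hp
  let d : N →₀ ℤ := Finsupp.onFinset (bd f0).support d0 (by
    intro n hn
    rw [Finsupp.mem_support_iff, hd0 n]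
    exact mul_ne_zero hp0 hn)
  have hd1 : bd f0 = (p : ℤ) • d := by
    ext n
    simp only [Finsupp.smul_apply, smul_eq_mul]
    exact hd0 n
  have hd2 : Finsupp.mapDomain π d = 0 := by
    have := h4 f0
    rw [hd1, Finsupp.mapDomain_smul] at this
    exact (smul_eq_zero.mp this).resolve_left hp0
  obtain ⟨k, hk⟩ := h3 d hd2
  refine ⟨f0 - (p : ℤ) • k, ?_, ?_⟩
  · rw [← sub_eq_zero, ← hbd, map_sub, map_zsmul, hk, hd1, sub_self]
  · intro e
    simp [hf0]

lemma rank_eq_of_lift {b w : ℕ} (M : Matrix (Fin b) (Fin w) ℤ) (p : ℕ) [Fact p.Prime]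
    (hl : ∀ x : Fin w → ZMod p, (M.map (Int.cast : ℤ → ZMod p)).mulVec x = 0 →
      ∃ y : Fin w → ℤ, M.mulVec y = 0 ∧ ∀ i, (y i : ZMod p) = x i) :
    (M.map (Int.cast : ℤ → ℚ)).rank = (M.map (Int.cast : ℤ → ZMod p)).rank := by
  classical
  let K : Submodule ℤ (Fin w → ℤ) := LinearMap.ker M.mulVecLin
  obtain ⟨n, ⟨B⟩⟩ : ∃ n, Nonempty (Module.Basis (Fin n) ℤ K) :=
    ⟨_, ⟨Module.finBasis ℤ K⟩⟩
  have hB : ∀ i, M.mulVec (B i) = 0 := fun i => (B i).2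
  -- generic: nullity is n as soon as the reductions are independent and spanning
  have key : ∀ (F : Type) [Field F], (∀ c : Fin n → F, 
      (∑ i, c i • (fun j => (((B i : Fin w → ℤ) j : ℤ) : F))) = 0 → c = 0) →
      (∀ x : Fin w → F, (M.map (Int.cast : ℤ → F)).mulVec x = 0 → 
        x ∈ Submodule.span F (Set.range (fun i j => (((B i : Fin w → ℤ) j : ℤ) : F)))) →
      (M.map (Int.cast : ℤ → F)).rank + n = w := by
    intro F _ h1 h2
    have hli : LinearIndependent F (fun i j => (((B i : Fin w → ℤ) j : ℤ) : F)) := by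
      rw [Fintype.linearIndependent_iff]
      intro g hg i
      exact congrFun (h1 g hg) i
    have hker : LinearMap.ker (M.map (Int.cast : ℤ → F)).mulVecLin =
        Submodule.span F (Set.range (fun i j => (((B i : Fin w → ℤ) j : ℤ) : F))) := by
      apply le_antisymm
      · intro x hx
        exact h2 x hx
      · rw [Submodule.span_le]
        rintro _ ⟨i, rfl⟩
        change (M.map (Int.cast : ℤ → F)).mulVec _ = 0
        have := congrArg (fun v : Fin b → ℤ => fun j => ((v j : ℤ) : F)) (hB i)
        funext j
        have := congrFun this j
        simpa [Matrix.mulVec, dotProduct] using this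
    have h3 := LinearMap.finrank_range_add_finrank_ker (M.map (Int.cast : ℤ → F)).mulVecLin
    rw [hker, finrank_span_eq_card hli] at h3
    simpa [Matrix.rank] using h3
  have hdiv : ∀ (m : ℤ), m ≠ 0 → ∀ x : Fin w → ℤ, M.mulVec (m • x) = 0 → M.mulVec x = 0 := by
    intro m hm x hx
    rw [Matrix.mulVec_smul] at hx
    exact (smul_eq_zero.mp hx).resolve_left hm
  have hQ := key ℚ ?_ ?_
  have hP := key (ZMod p) ?_ ?_
  · omega
  · intro c hc
    choose c' hc' using fun i => ZMod.intCast_surjective (c i)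
    have hp0 : (p : ℤ) ≠ 0 := by exact_mod_cast (Fact.out : p.Prime).ne_zero
    have : ∀ j, (p : ℤ) ∣ (∑ i, c' i • (B i : Fin w → ℤ)) j := by
      intro j
      rw [← ZMod.intCast_zmod_eq_zero_iff_dvd]
      have := congrFun hc j
      simpa [hc'] using this
    choose x hx using this
    have hx' : (∑ i, c' i • (B i : Fin w → ℤ)) = (p : ℤ) • x := by
      funext j; simpa using hx j
    have hxK : x ∈ K := by
      apply hdiv p hp0
      rw [← hx']
      have h4 : M.mulVec ((∑ i, c' i • B i : K) : Fin w → ℤ) = 0 := (∑ i, c' i • B i : K).2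
      simpa using h4
    have h5 : (∑ i, c' i • B i : K) = (p : ℤ) • (⟨x, hxK⟩ : K) := by
      apply Subtype.ext
      simpa using hx'
    funext i
    have h6 := congrArg (fun z => B.repr z i) h5
    simp only [map_smul, Finsupp.smul_apply, B.repr_sum_self] at h6
    rw [← hc' i, h6]
    simp
  · intro x hx
    obtain ⟨y, hy, hyx⟩ := hl x hx
    obtain ⟨r, h5⟩ : ∃ r : Fin n → ℤ, ∑ i, r i • B i = (⟨y, hy⟩ : K) := ⟨_, B.sum_repr ⟨y, hy⟩⟩
    have h6 := congrArg (fun z : K => (z : Fin w → ℤ)) h5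
    have : x = ∑ i, ((r i : ℤ) : ZMod p) • (fun j => (((B i : Fin w → ℤ) j : ℤ) : ZMod p)) := by
      funext j
      rw [← hyx j]
      have h7 := congrArg (fun z : ℤ => (z : ZMod p)) (congrFun h6 j)
      simp at h7
      simp [← h7]
    rw [this]
    exact Submodule.sum_mem _ fun i _ => Submodule.smul_mem _ _ (Submodule.subset_span ⟨i, rfl⟩)
  · intro c hc
    obtain ⟨m, hm⟩ := IsLocalization.exist_integer_multiples_of_finset (nonZeroDivisors ℤ) (Finset.univ.image c)
    have hm0 : (m : ℤ) ≠ 0 := nonZeroDivisors.ne_zero m.2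
    have hm' : ∀ i, ∃ z : ℤ, (z : ℚ) = (m : ℤ) * c i := by
      intro i
      obtain ⟨z, hz⟩ := hm (c i) (by simp)
      exact ⟨z, by simpa [Algebra.smul_def] using hz⟩
    choose z hz using hm'
    have h5 : (∑ i, z i • B i : K) = 0 := by
      apply Subtype.ext
      funext j
      have h7 := congrArg (fun t : ℚ => (m : ℤ) * t) (congrFun hc j)
      simp only [Finset.sum_apply, Pi.smul_apply, smul_eq_mul, Finset.mul_sum, ← mul_assoc, ← hz] at h7
      have : (((∑ i, z i * (B i : Fin w → ℤ) j : ℤ)) : ℚ) = 0 := by simpa using h7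
      have := Int.cast_eq_zero.mp this
      simpa using this
    funext i
    have h6 := congrArg (fun z => B.repr z i) h5
    simp only [B.repr_sum_self] at h6
    have h7 := hz i
    rw [h6] at h7
    simp [hm0] at h7
    simpa using h7
  · intro x hx
    obtain ⟨m, hm⟩ := IsLocalization.exist_integer_multiples_of_finset (nonZeroDivisors ℤ) (Finset.univ.image x)
    have hm0 : (m : ℤ) ≠ 0 := nonZeroDivisors.ne_zero m.2
    have hm' : ∀ i, ∃ z : ℤ, (z : ℚ) = (m : ℤ) * x i := by
      intro i
      obtain ⟨z, hz⟩ := hm (x i) (by simp)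
      exact ⟨z, by simpa [Algebra.smul_def] using hz⟩
    choose y hyx using hm'
    have hy : M.mulVec y = 0 := by
      funext j
      have h7 := congrArg (fun t : ℚ => (m : ℤ) * t) (congrFun hx j)
      simp only [Matrix.mulVec, dotProduct, Finset.mul_sum, Matrix.map_apply] at h7
      have h8 : (((∑ i, M j i * y i : ℤ)) : ℚ) = 0 := by
        push_cast
        simp only [hyx]
        rw [Pi.zero_apply, mul_zero] at h7
        rw [← h7]
        exact Finset.sum_congr rfl fun i _ => by ring
      exact Int.cast_eq_zero.mp h8
    obtain ⟨r, h5⟩ : ∃ r : Fin n → ℤ, ∑ i, r i • B i = (⟨y, hy⟩ : K) := ⟨_, B.sum_repr ⟨y, hy⟩⟩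
    have h6 := congrArg (fun z : K => (z : Fin w → ℤ)) h5
    have : ((m : ℤ) : ℚ) • x = ∑ i, ((r i : ℤ) : ℚ) • (fun j => (((B i : Fin w → ℤ) j : ℤ) : ℚ)) := by
      funext j
      have h7 := congrArg (fun z : ℤ => (z : ℚ)) (congrFun h6 j)
      simp at h7
      simp [← hyx, ← h7]
    have hmem : ((m : ℤ) : ℚ) • x ∈ Submodule.span ℚ (Set.range (fun i j => (((B i : Fin w → ℤ) j : ℤ) : ℚ))) := by
      rw [this]
      exact Submodule.sum_mem _ fun i _ => Submodule.smul_mem _ _ (Submodule.subset_span ⟨i, rfl⟩)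
    exact (Submodule.smul_mem_iff _ (by exact_mod_cast hm0)).mp hmem

open unitInterval in
/-- Every circle-valued map on the region of a board lifts to the line. -/
lemma board_lift {S : Finset Cell} (hS : IsBoard S) (f : C(Region S, AddCircle (1 : ℝ))) :
    ∃ θ : C(Region S, ℝ), ∀ z, ((θ z : ℝ) : AddCircle (1 : ℝ)) = f z := by
  obtain ⟨-, ⟨e⟩⟩ := hS
  have cov := AddCircle.isCoveringMap_coe (1 : ℝ)
  have hmem : ∀ (t : I) (x : Metric.closedBall (0 : EuclideanSpace ℝ (Fin 2)) 1),
      (t : ℝ) • (x : EuclideanSpace ℝ (Fin 2)) ∈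
        Metric.closedBall (0 : EuclideanSpace ℝ (Fin 2)) 1 := by
    intro t x
    have hx := x.2
    rw [mem_closedBall_zero_iff] at hx ⊢
    rw [norm_smul, Real.norm_eq_abs, abs_of_nonneg t.2.1]
    exact mul_le_one₀ t.2.2 (norm_nonneg _) hx
  let H : C(I × Region S, AddCircle (1 : ℝ)) :=
    ⟨fun q => f (e.symm ⟨(q.1 : ℝ) • (e q.2 : EuclideanSpace ℝ (Fin 2)), hmem q.1 (e q.2)⟩), by
      fun_prop⟩
  obtain ⟨r, hr⟩ := QuotientAddGroup.mk_surjective (f (e.symm ⟨0, by simp⟩))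
  have h0 : ∀ a : Region S, H (0, a) = ((ContinuousMap.const (Region S) r a : ℝ) :
      AddCircle (1 : ℝ)) := by
    intro a
    simp only [H, ContinuousMap.coe_mk, ContinuousMap.const_apply]
    rw [show (r : AddCircle (1 : ℝ)) = f (e.symm ⟨0, by simp⟩) from hr]
    simp
  refine ⟨⟨fun z => cov.liftHomotopy H (ContinuousMap.const _ r) h0 (1, z), by fun_prop⟩,
    fun z => ?_⟩
  have := congrFun (cov.liftHomotopy_lifts H (ContinuousMap.const _ r) h0) (1, z)
  simp only [Function.comp] at this
  simp only [ContinuousMap.coe_mk]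
  rw [this]
  simp [H]

/-- A continuous integer-valued function along a segment is constant. -/
lemma const_of_int (g : ℝ → ℝ) (hg : ContinuousOn g (Set.Icc 0 1))
    (hi : ∀ t ∈ Set.Icc (0 : ℝ) 1, ∃ n : ℤ, g t = n) : g 1 = g 0 := by
  have h := (isPreconnected_Icc (a := (0:ℝ)) (b := 1)).image g hg
  by_contra hne
  have hoc := h.ordConnected
  have h0 : g 0 ∈ g '' Set.Icc 0 1 := ⟨0, by simp, rfl⟩
  have h1 : g 1 ∈ g '' Set.Icc 0 1 := ⟨1, by simp, rfl⟩
  obtain ⟨a, ha⟩ := hi 0 (by simp)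
  obtain ⟨b, hb⟩ := hi 1 (by simp)
  have hab : b ≠ a := by rintro rfl; exact hne (hb.trans ha.symm)
  have key : ∀ x y : ℤ, x < y → (x : ℝ) ∈ g '' Set.Icc 0 1 → (y : ℝ) ∈ g '' Set.Icc 0 1 →
      False := by
    intro x y hxy hx hy
    have : ((x : ℝ) + 1/2) ∈ g '' Set.Icc 0 1 := hoc.out hx hy (by
      have : (x : ℝ) + 1 ≤ y := by exact_mod_cast hxy
      constructor <;> linarith)
    obtain ⟨t, ht, hte⟩ := this
    obtain ⟨n, hn⟩ := hi t ht
    have h2 : ((2 * n : ℤ) : ℝ) = ((2 * x + 1 : ℤ) : ℝ) := by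
      push_cast; linarith
    have := Int.cast_injective h2
    omega
  rw [ha] at h0
  rw [hb] at h1
  rcases lt_or_gt_of_ne hab with h | h
  · exact key _ _ h h1 h0
  · exact key _ _ h h0 h1

lemma mem_region {S : Finset Cell} {q : Cell} (hq : q ∈ S) {z : ℝ × ℝ} (hz : z ∈ unitSquare q) :
    z ∈ Region S := by
  simp only [Region, Set.mem_iUnion]
  exact ⟨q, hq, hz⟩

/-- The missing cell is avoided by the region. -/
lemma region_avoid {S : Finset Cell} {c : Cell} (hc : c ∉ S) {z : ℝ × ℝ} (hz : z ∈ Region S)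
    (hx : z.1 = c.1 + 1 / 2) : z.2 ≤ c.2 ∨ (c.2 : ℝ) + 1 ≤ z.2 := by
  simp only [Region, Set.mem_iUnion] at hz
  obtain ⟨q, hq, hz⟩ := hz
  obtain ⟨⟨h1, h2⟩, h3, h4⟩ := hz
  rw [hx] at h1 h2
  have e1 : q.1 = c.1 := by
    have a1 : ((2 * q.1 : ℤ) : ℝ) ≤ ((2 * c.1 + 1 : ℤ) : ℝ) := by push_cast; linarith
    have a2 : ((2 * c.1 + 1 : ℤ) : ℝ) ≤ ((2 * q.1 + 2 : ℤ) : ℝ) := by push_cast; linarith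
    have a1 := Int.cast_le.mp a1
    have a2 := Int.cast_le.mp a2
    omega
  have e2 : q.2 ≠ c.2 := fun e2 => hc (by rwa [← (Prod.ext e1 e2 : q = c)])
  rcases lt_or_gt_of_ne e2 with h | h
  · left
    have : (q.2 : ℝ) + 1 ≤ c.2 := by exact_mod_cast h
    linarith
  · right
    have : (c.2 : ℝ) + 1 ≤ q.2 := by exact_mod_cast h
    linarith

/-- Existence of a discrete angle function on the lattice points of a board. -/
lemma board_angle {S : Finset Cell} (hS : IsBoard S) {c : Cell} (hc : c ∉ S) :
    ∃ θ : ℤ → ℤ → ℝ,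
      (∀ x y : ℤ, ((x, y) ∈ S ∨ (x, y - 1) ∈ S) → θ (x + 1) y = θ x y) ∧
      (∀ x y : ℤ, ((x, y) ∈ S ∨ (x - 1, y) ∈ S) → θ x (y + 1) = θ x y +
        if c.1 + 1 ≤ x ∧ y = c.2 then 1 else 0) := by
  classical
  let G : ℝ × ℝ → ℝ := fun z => max 0 (min 1 (z.2 - c.2))
  have hG : Continuous G := by fun_prop
  have hG0 : ∀ z : ℝ × ℝ, z.2 ≤ c.2 → G z = 0 := by
    intro z hz
    simp only [G]
    rw [max_eq_left]
    exact (min_le_right _ _).trans (by linarith)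
  have hG1 : ∀ z : ℝ × ℝ, (c.2 : ℝ) + 1 ≤ z.2 → G z = 1 := by
    intro z hz
    simp only [G]
    rw [min_eq_left (by linarith)]; simp
  let F : Region S → AddCircle (1 : ℝ) := fun z =>
    if (c.1 : ℝ) + 1 / 2 ≤ (z : ℝ × ℝ).1 then ((G z : ℝ) : AddCircle (1 : ℝ)) else 0
  have hF : Continuous F := by
    refine Continuous.if_le (f' := fun z : Region S => ((G z : ℝ) : AddCircle (1 : ℝ)))
      (g' := fun _ => 0) ?_ continuous_const continuous_const (by fun_prop) ?_
    · exact (AddCircle.continuous_mk' 1).comp (hG.comp continuous_subtype_val)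
    · intro z hz
      rcases region_avoid hc z.2 hz.symm with h | h
      · rw [hG0 _ h]; simp
      · rw [hG1 _ h]
        exact AddCircle.coe_period 1
  obtain ⟨L, hL⟩ := board_lift hS ⟨F, hF⟩
  have hL1 : ∀ z : Region S, (c.1 : ℝ) + 1 / 2 ≤ (z : ℝ × ℝ).1 → ∃ n : ℤ, L z - G z = n := by
    intro z hz
    have := hL z
    simp only [ContinuousMap.coe_mk, F, if_pos hz] at this
    rw [← sub_eq_zero, ← AddCircle.coe_sub, AddCircle.coe_eq_zero_iff] at this
    obtain ⟨n, hn⟩ := this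
    exact ⟨n, by simpa using hn.symm⟩
  have hL2 : ∀ z : Region S, (z : ℝ × ℝ).1 < (c.1 : ℝ) + 1 / 2 → ∃ n : ℤ, L z = n := by
    intro z hz
    have := hL z
    simp only [ContinuousMap.coe_mk, F, if_neg (not_le.mpr hz)] at this
    rw [AddCircle.coe_eq_zero_iff] at this
    obtain ⟨n, hn⟩ := this
    exact ⟨n, by simpa using hn.symm⟩
  have hG2 : ∀ z : ℝ × ℝ, z.2 ≤ c.2 ∨ (c.2 : ℝ) + 1 ≤ z.2 → ∃ n : ℤ, G z = n := by
    rintro z (h | h)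
    · exact ⟨0, by simp [hG0 z h]⟩
    · exact ⟨1, by simp [hG1 z h]⟩
  have hL3 : ∀ z : Region S, (z : ℝ × ℝ).2 ≤ c.2 ∨ (c.2 : ℝ) + 1 ≤ (z : ℝ × ℝ).2 →
      ∃ n : ℤ, L z = n := by
    intro z hz
    by_cases h : (c.1 : ℝ) + 1 / 2 ≤ (z : ℝ × ℝ).1
    · obtain ⟨n, hn⟩ := hL1 z h
      obtain ⟨m, hm⟩ := hG2 z hz
      exact ⟨n + m, by push_cast; linarith⟩
    · exact hL2 z (not_le.mp h)
  let L' : ℝ × ℝ → ℝ := fun z => if h : z ∈ Region S then L ⟨z, h⟩ else 0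
  have hL' : ContinuousOn L' (Region S) := by
    rw [continuousOn_iff_continuous_domRestrict]
    convert L.continuous using 1
    funext z
    simp [L']
  have hL'e : ∀ z (h : z ∈ Region S), L' z = L ⟨z, h⟩ := fun z h => by simp [L', h]
  refine ⟨fun x y => L' ((x : ℝ), (y : ℝ)), ?_, ?_⟩
  · intro x y hxy
    have hmem : ∀ t ∈ Set.Icc (0 : ℝ) 1, ((x : ℝ) + t, (y : ℝ)) ∈ Region S := by
      intro t ht
      rcases hxy with h | h
      · exact mem_region h ⟨⟨by simp [ht.1], by simp [ht.2]⟩, by simp, by simp⟩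
      · exact mem_region h ⟨⟨by simp [ht.1], by simp [ht.2]⟩, by simp, by simp⟩
    have := const_of_int (fun t => L' ((x : ℝ) + t, (y : ℝ)))
      (hL'.comp (by fun_prop) hmem) (by
        intro t ht
        rw [hL'e _ (hmem t ht)]
        apply hL3
        rcases le_or_gt y c.2 with h | h
        · left
          change (y : ℝ) ≤ c.2
          exact_mod_cast h
        · right
          change (c.2 : ℝ) + 1 ≤ y
          exact_mod_cast h)
    simpa using this
  · intro x y hxy
    have hmem : ∀ t ∈ Set.Icc (0 : ℝ) 1, ((x : ℝ), (y : ℝ) + t) ∈ Region S := by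
      intro t ht
      rcases hxy with h | h
      · exact mem_region h ⟨⟨by simp, by simp⟩, by simp [ht.1], by simp [ht.2]⟩
      · exact mem_region h ⟨⟨by simp, by simp⟩, by simp [ht.1], by simp [ht.2]⟩
    by_cases hx : c.1 + 1 ≤ x
    · have hx' : (c.1 : ℝ) + 1 / 2 ≤ x := by
        have : (c.1 : ℝ) + 1 ≤ x := by exact_mod_cast hx
        linarith
      have := const_of_int (fun t => L' ((x : ℝ), (y : ℝ) + t) - G ((x : ℝ), (y : ℝ) + t))
        ((hL'.comp (by fun_prop) hmem).sub (hG.comp (by fun_prop)).continuousOn) (by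
          intro t ht
          rw [hL'e _ (hmem t ht)]
          exact hL1 ⟨_, hmem t ht⟩ hx')
      simp only [add_zero] at this
      by_cases hy : y = c.2
      · subst hy
        rw [hG0 (_, (c.2 : ℝ)) le_rfl, hG1 (_, (c.2 : ℝ) + 1) le_rfl] at this
        simp only [hx, and_self, if_true]
        push_cast
        linarith
      · have : G ((x : ℝ), (y : ℝ) + 1) = G ((x : ℝ), (y : ℝ)) := by
          rcases lt_or_gt_of_ne hy with h | h
          · have : (y : ℝ) + 1 ≤ c.2 := by exact_mod_cast h
            rw [hG0 _ (by simpa using this), hG0 _ (by simp only; linarith)]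
          · have : (c.2 : ℝ) + 1 ≤ y := by exact_mod_cast h
            rw [hG1 _ (by simp only; linarith), hG1 _ (by simpa using this)]
        simp only [hy, and_false, if_false]
        push_cast
        linarith
    · have hx' : (x : ℝ) < (c.1 : ℝ) + 1 / 2 := by
        have : (x : ℝ) ≤ c.1 := by exact_mod_cast (by omega : x ≤ c.1)
        linarith
      have := const_of_int (fun t => L' ((x : ℝ), (y : ℝ) + t))
        (hL'.comp (by fun_prop) hmem) (by
          intro t ht
          rw [hL'e _ (hmem t ht)]
          exact hL2 ⟨_, hmem t ht⟩ hx')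
      simp only [hx, false_and, if_false]
      simpa using this

lemma sum_shift_s11 {D : Finset Cell} (e : Cell) (v : Cell → ℝ)
    (h1 : ∀ q ∈ D, q - e ∉ D → v q = 0) (h2 : ∀ q ∈ D, q + e ∉ D → v (q + e) = 0) :
    ∑ q ∈ D, v (q + e) = ∑ q ∈ D, v q := by
  classical
  have : ∑ q ∈ D, v (q + e) = ∑ q ∈ D.image (· + e), v q := by
    rw [Finset.sum_image]
    intro a _ b _ h
    exact add_right_cancel h
  rw [this]
  rw [← Finset.sum_subset (Finset.inter_subset_left (s₁ := D.image (· + e)) (s₂ := D)),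
    ← Finset.sum_subset (Finset.inter_subset_right (s₁ := D.image (· + e)) (s₂ := D))]
  · intro q hq hq'
    apply h1 q hq
    intro h
    exact hq' (Finset.mem_inter.mpr ⟨Finset.mem_image.mpr ⟨q - e, h, by simp⟩, hq⟩)
  · intro q hq hq'
    obtain ⟨r, hr, rfl⟩ := Finset.mem_image.mp hq
    apply h2 r hr
    intro h
    exact hq' (Finset.mem_inter.mpr ⟨hq, h⟩)

/-- The missing cells of a board have no bounded component. -/
lemma board_no_hole {S : Finset Cell} (hS : IsBoard S) (D : Finset Cell)
    (hD : ∀ q ∈ D, q ∉ S) (hcl : ∀ q ∈ D, ∀ r, Adjacent q r → r ∉ S → r ∈ D) : D = ∅ := by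
  classical
  by_contra hne
  obtain ⟨c, hc⟩ := Finset.nonempty_iff_ne_empty.mpr hne
  obtain ⟨θ, hh, hv⟩ := board_angle hS (hD c hc)
  let V : Cell → ℝ := fun q => θ q.1 (q.2 + 1) - θ q.1 q.2 -
    if c.1 + 1 ≤ q.1 ∧ q.2 = c.2 then 1 else 0
  let H : Cell → ℝ := fun q => θ (q.1 + 1) q.2 - θ q.1 q.2
  have hV0 : ∀ q ∈ S, V q = 0 := by
    intro q hq
    simp only [V]
    rw [hv q.1 q.2 (Or.inl hq)]
    ring
  have hH0 : ∀ q ∈ S, H q = 0 := by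
    intro q hq
    simp only [H]
    rw [hh q.1 q.2 (Or.inl hq)]
    ring
  have s1 : ∑ q ∈ D, V (q + (1, 0)) = ∑ q ∈ D, V q := by
    apply sum_shift_s11
    · intro q hq hq'
      have : q - (1, 0) ∈ S := by
        by_contra hs
        exact hq' (hcl q hq _ (by simp [Adjacent]) hs)
      simp only [V]
      rw [hv q.1 q.2 (Or.inr (by convert this using 1; ext <;> simp))]
      ring
    · intro q hq hq'
      have : q + (1, 0) ∈ S := by
        by_contra hs
        exact hq' (hcl q hq _ (by simp [Adjacent]) hs)
      exact hV0 _ this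
  have s2 : ∑ q ∈ D, H (q + (0, 1)) = ∑ q ∈ D, H q := by
    apply sum_shift_s11
    · intro q hq hq'
      have : q - (0, 1) ∈ S := by
        by_contra hs
        exact hq' (hcl q hq _ (by simp [Adjacent]) hs)
      simp only [H]
      rw [hh q.1 q.2 (Or.inr (by convert this using 1; ext <;> simp))]
      ring
    · intro q hq hq'
      have : q + (0, 1) ∈ S := by
        by_contra hs
        exact hq' (hcl q hq _ (by simp [Adjacent]) hs)
      exact hH0 _ this
  have s3 : ∀ q : Cell, V (q + (1, 0)) - V q - (H (q + (0, 1)) - H q) =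
      if q = c then -1 else 0 := by
    intro q
    simp only [V, H, Prod.fst_add, Prod.snd_add, add_zero]
    have : (q = c) ↔ q.1 = c.1 ∧ q.2 = c.2 := Prod.ext_iff
    simp only [this]
    split_ifs <;> first | omega | ring
  clear_value V H
  have s4 := Finset.sum_congr (rfl : D = D) (fun q _ => s3 q)
  rw [Finset.sum_sub_distrib, Finset.sum_sub_distrib, Finset.sum_sub_distrib, s1, s2,
    Finset.sum_ite_eq' D c] at s4
  simp [hc] at s4


/-- The local node containing the `i`-th edge around a black cell: `pb` says whether the black cell
is present, `m i` whether the `i`-th white corner is missing. -/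
def nodeLabel (pb m0 m1 m2 m3 : Bool) (i : Fin 4) : Fin 4 :=
  if pb then ![0, 1, 0, 1] i
  else ![if m0 then 0 else if m3 then 3 else if m2 then 2 else if m1 then 1 else 0,
    if m1 then 1 else if m0 then 0 else if m3 then 3 else if m2 then 2 else 0,
    if m2 then 2 else if m1 then 1 else if m0 then 0 else if m3 then 3 else 0,
    if m3 then 3 else if m2 then 2 else if m1 then 1 else 0] i

/-- Conservation at the local node `j`. -/
def NodeBal {R : Type*} [CommRing R] (l : Fin 4 → Fin 4) (au gl ad gr : R) (j : Fin 4) : Prop :=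
  (if l 2 = j then ad else 0) + (if l 3 = j then gr else 0) =
    (if l 0 = j then au else 0) + (if l 1 = j then gl else 0)

lemma nodeBal_of {R : Type*} [CommRing R] (pb m0 m1 m2 m3 : Bool) (A B C D : R)
    (h0 : m0 = true → A = 0) (h1 : m1 = true → B = 0) (h2 : m2 = true → C = 0)
    (h3 : m3 = true → D = 0) (hb : pb = true → A - B - D + C = 0) (j : Fin 4) :
    NodeBal (nodeLabel pb m0 m1 m2 m3) (A - B) (B - C) (D - C) (A - D) j := by
  cases pb
  · clear hb
    cases m0 <;> cases m1 <;> cases m2 <;> cases m3 <;>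
      simp only [forall_const, Bool.false_eq_true, false_imp_iff] at h0 h1 h2 h3 <;>
      subst_vars <;> fin_cases j <;> simp [NodeBal, nodeLabel] <;> ring
  · have hb := hb rfl
    clear h0 h1 h2 h3
    fin_cases j <;> simp [NodeBal, nodeLabel] <;>
      first | linear_combination hb | linear_combination -hb

lemma total_of_nodeBal {R : Type*} [CommRing R] (l : Fin 4 → Fin 4) (au gl ad gr : R)
    (h : ∀ j, NodeBal l au gl ad gr j) : ad + gr = au + gl := by
  have := Finset.sum_congr (rfl : (Finset.univ : Finset (Fin 4)) = Finset.univ) (fun j _ => h j)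
  simpa [Finset.sum_add_distrib] using this

lemma of_nodeBal {R : Type*} [CommRing R] (pb m0 m1 m2 m3 : Bool) (A B C D : R)
    (h : ∀ j, NodeBal (nodeLabel pb m0 m1 m2 m3) (A - B) (B - C) (D - C) (A - D) j) :
    (pb = true → A - B - D + C = 0) ∧
    (pb = false → (m0 = true → m1 = true → A = B) ∧ (m0 = true → m2 = true → A = C) ∧
      (m0 = true → m3 = true → A = D) ∧ (m1 = true → m2 = true → B = C) ∧
      (m1 = true → m3 = true → B = D) ∧ (m2 = true → m3 = true → C = D)) := by
  have e0 := h 0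
  have e1 := h 1
  have e2 := h 2
  have e3 := h 3
  clear h
  constructor
  · rintro rfl
    simp [NodeBal, nodeLabel] at e0
    linear_combination -e0
  · rintro rfl
    cases m0 <;> cases m1 <;> cases m2 <;> cases m3 <;>
      simp [NodeBal, nodeLabel] at e0 e1 e2 e3 ⊢ <;> grind

lemma tele {A : Type*} [AddCommGroup A] (φ : ℤ → A) (N : ℤ) (h : ∀ u, φ u = φ (u - 1))
    (h0 : ∀ u ≤ N, φ u = 0) (u : ℤ) : φ u = 0 := by
  rcases le_or_gt u N with hu | hu
  · exact h0 u hu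
  · obtain ⟨n, rfl⟩ : ∃ n : ℕ, u = N + n := ⟨(u - N).toNat, by omega⟩
    clear hu
    induction n with
    | zero => exact h0 _ (by simp)
    | succ n ih =>
      rw [h]
      convert ih using 2
      push_cast
      ring

/-- A finitely supported discrete 1-form, closed, is the differential of a finitely supported
function. -/
lemma primitive (a g : ℤ → ℤ → ℤ) (N : ℤ) (hN : 0 ≤ N)
    (ha : ∀ u v, a u v ≠ 0 → -N < u ∧ u < N ∧ -N < v ∧ v < N)
    (hg : ∀ u v, g u v ≠ 0 → -N < u ∧ u < N ∧ -N < v ∧ v < N)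
    (hc : ∀ u v, a u (v - 1) + g u v = a u v + g (u - 1) v) :
    ∃ k : ℤ → ℤ → ℤ, (∀ u v, k u v - k (u - 1) v = a u v) ∧ (∀ u v, k u v - k u (v - 1) = g u v) ∧
      (∀ u v, k u v ≠ 0 → -N < u ∧ u < N ∧ -N < v ∧ v < N) := by
  have ha' : ∀ u v, ¬ (-N < u ∧ u < N ∧ -N < v ∧ v < N) → a u v = 0 := fun u v h => by
    by_contra h'; exact h (ha u v h')
  have hg' : ∀ u v, ¬ (-N < u ∧ u < N ∧ -N < v ∧ v < N) → g u v = 0 := fun u v h => by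
    by_contra h'; exact h (hg u v h')
  let k : ℤ → ℤ → ℤ := fun u v => ∑ i ∈ Finset.Ioc (-N) u, a i v
  have k0 : ∀ u v, u ≤ -N → k u v = 0 := by
    intro u v hu
    simp only [k]
    rw [Finset.Ioc_eq_empty (by omega), Finset.sum_empty]
  have k1 : ∀ u v, k u v - k (u - 1) v = a u v := by
    intro u v
    by_cases hu : -N < u
    · have : Finset.Ioc (-N) u = insert u (Finset.Ioc (-N) (u - 1)) := by
        ext i; simp only [Finset.mem_Ioc, Finset.mem_insert]; omega
      simp only [k]
      rw [this, Finset.sum_insert (by simp)]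
      ring
    · rw [k0 u v (by omega), k0 (u - 1) v (by omega), ha' u v (by omega)]; ring
  clear_value k
  have k2 : ∀ u v, k u v - k u (v - 1) = g u v := by
    intro u v
    have := tele (fun u => k u v - k u (v - 1) - g u v) (-N) (by
      intro u
      have e1 := k1 u v
      have e2 := k1 u (v - 1)
      have e3 := hc u v
      linarith) (by
      intro u hu
      rw [k0 u v hu, k0 u _ hu, hg' u v (by omega)]; ring) u
    exact sub_eq_zero.mp this
  have k3 : ∀ u v, v ≤ -N ∨ N ≤ v → k u v = 0 := by
    intro u v hv
    refine tele (fun u => k u v) (-N) ?_ (fun u hu => k0 u v hu) u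
    intro u
    have := k1 u v
    rw [ha' u v (by omega)] at this
    linarith
  have k4 : ∀ u v, N ≤ u → k u v = 0 := by
    intro u v hu
    refine tele (fun v => k u v) (-N) ?_ (fun v hv => k3 u v (Or.inl hv)) v
    intro v
    have := k2 u v
    rw [hg' u v (by omega)] at this
    linarith
  refine ⟨k, k1, k2, fun u v h => ?_⟩
  by_contra hcon
  apply h
  by_cases c1 : u ≤ -N
  · exact k0 u v c1
  by_cases c2 : N ≤ u
  · exact k4 u v c2
  exact k3 u v (by omega)

/-- Lifting of mod `p` solutions, abstract version on the rotated lattice. -/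
lemma lift_core (p : ℕ) (hp : p ≠ 0) (PB PW : ℤ → ℤ → Prop) (h : ℤ → ℤ → ZMod p) (N : ℤ)
    (hN : ∀ u v, h u v ≠ 0 → -N < u ∧ u < N ∧ -N < v ∧ v < N)
    (hW : ∀ u v, ¬ PW u v → h u v = 0)
    (hB : ∀ u v, PB u v → h u v - h (u - 1) v - h u (v - 1) + h (u - 1) (v - 1) = 0) :
    ∃ (k : ℤ → ℤ → ℤ) (M : ℤ), (∀ u v, (k u v : ZMod p) = h u v) ∧
      (∀ u v, k u v ≠ 0 → -M < u ∧ u < M ∧ -M < v ∧ v < M) ∧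
      (∀ u v, PB u v → k u v - k (u - 1) v - k u (v - 1) + k (u - 1) (v - 1) = 0) ∧
      (∀ u v, ¬ PB u v → ∀ a b a' b', (a = u ∨ a = u - 1) → (b = v ∨ b = v - 1) →
        (a' = u ∨ a' = u - 1) → (b' = v ∨ b' = v - 1) → ¬ PW a b → ¬ PW a' b' →
        k a b = k a' b') := by
  classical
  let lab : ℤ → ℤ → Fin 4 → Fin 4 := fun u v => nodeLabel (decide (PB u v))
    (decide (¬ PW u v)) (decide (¬ PW (u - 1) v)) (decide (¬ PW (u - 1) (v - 1)))
    (decide (¬ PW u (v - 1)))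
  let hd : ((ℤ × ℤ) ⊕ (ℤ × ℤ)) → ℤ × ℤ × Fin 4 := Sum.elim (fun q => (q.1, q.2 + 1, lab q.1 (q.2 + 1) 2))
    (fun q => (q.1, q.2, lab q.1 q.2 3))
  let tl : ((ℤ × ℤ) ⊕ (ℤ × ℤ)) → ℤ × ℤ × Fin 4 := Sum.elim (fun q => (q.1, q.2, lab q.1 q.2 0))
    (fun q => (q.1 + 1, q.2, lab (q.1 + 1) q.2 1))
  have mhd : ∀ {R : Type} [CommRing R] (f : ((ℤ × ℤ) ⊕ (ℤ × ℤ)) →₀ R) (u v : ℤ) (j : Fin 4),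
      Finsupp.mapDomain hd f (u, v, j) = (if lab u v 2 = j then f (Sum.inl (u, v - 1)) else 0) +
        (if lab u v 3 = j then f (Sum.inr (u, v)) else 0) := by
    intro R _ f u v j
    induction f using Finsupp.induction_linear with
    | zero => simp
    | add x y hx hy =>
      rw [Finsupp.mapDomain_add, Finsupp.add_apply, hx, hy]
      simp only [Finsupp.add_apply]
      split_ifs <;> ring
    | single e a =>
      rw [Finsupp.mapDomain_single]
      rcases e with ⟨x, y⟩ | ⟨x, y⟩
      · by_cases hxy : x = u ∧ y = v - 1
        · obtain ⟨rfl, rfl⟩ := hxy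
          simp [hd, Finsupp.single_apply]
        · have : ¬ (x = u ∧ y + 1 = v) := fun hh => hxy ⟨hh.1, by omega⟩
          simp [hd, Finsupp.single_apply, hxy]
          tauto
      · by_cases hxy : x = u ∧ y = v
        · obtain ⟨rfl, rfl⟩ := hxy
          simp [hd, Finsupp.single_apply]
        · simp [hd, Finsupp.single_apply, hxy]
          tauto
  have mtl : ∀ {R : Type} [CommRing R] (f : ((ℤ × ℤ) ⊕ (ℤ × ℤ)) →₀ R) (u v : ℤ) (j : Fin 4),
      Finsupp.mapDomain tl f (u, v, j) = (if lab u v 0 = j then f (Sum.inl (u, v)) else 0) +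
        (if lab u v 1 = j then f (Sum.inr (u - 1, v)) else 0) := by
    intro R _ f u v j
    induction f using Finsupp.induction_linear with
    | zero => simp
    | add x y hx hy =>
      rw [Finsupp.mapDomain_add, Finsupp.add_apply, hx, hy]
      simp only [Finsupp.add_apply]
      split_ifs <;> ring
    | single e a =>
      rw [Finsupp.mapDomain_single]
      rcases e with ⟨x, y⟩ | ⟨x, y⟩
      · by_cases hxy : x = u ∧ y = v
        · obtain ⟨rfl, rfl⟩ := hxy
          simp [tl, Finsupp.single_apply]
        · simp [tl, Finsupp.single_apply, hxy]
          tauto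
      · by_cases hxy : x = u - 1 ∧ y = v
        · obtain ⟨rfl, rfl⟩ := hxy
          simp [tl, Finsupp.single_apply]
        · have : ¬ (x + 1 = u ∧ y = v) := fun hh => hxy ⟨by omega, hh.2⟩
          simp [tl, Finsupp.single_apply, hxy]
          tauto
  -- the mod p flow
  let f0 : ((ℤ × ℤ) ⊕ (ℤ × ℤ)) → ZMod p := Sum.elim (fun q => h q.1 q.2 - h (q.1 - 1) q.2)
    (fun q => h q.1 q.2 - h q.1 (q.2 - 1))
  have h0 : ∀ u v, ¬ (-N < u ∧ u < N ∧ -N < v ∧ v < N) → h u v = 0 := fun u v hh => by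
    by_contra h'; exact hh (hN u v h')
  let box : Finset (ℤ × ℤ) := Finset.Icc (-N) N ×ˢ Finset.Icc (-N) N
  let f : ((ℤ × ℤ) ⊕ (ℤ × ℤ)) →₀ ZMod p := Finsupp.onFinset (box.disjSum box) f0 (by
    rintro (⟨u, v⟩ | ⟨u, v⟩) hne
    · simp only [f0, Sum.elim_inl] at hne
      simp only [Finset.inl_mem_disjSum, box, Finset.mem_product, Finset.mem_Icc]
      by_contra hcon
      exact hne (by rw [h0 u v (by omega), h0 (u - 1) v (by omega), sub_zero])
    · simp only [f0, Sum.elim_inr] at hne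
      simp only [Finset.inr_mem_disjSum, box, Finset.mem_product, Finset.mem_Icc]
      by_contra hcon
      exact hne (by rw [h0 u v (by omega), h0 u (v - 1) (by omega), sub_zero]))
  have hf1 : ∀ u v, f (Sum.inl (u, v)) = h u v - h (u - 1) v := fun u v => rfl
  have hf2 : ∀ u v, f (Sum.inr (u, v)) = h u v - h u (v - 1) := fun u v => rfl
  obtain ⟨f', hbal, hf'⟩ := circ_lift p hp hd tl f (by
    ext ⟨u, v, j⟩
    rw [mhd, mtl, hf1, hf1, hf2, hf2]
    refine nodeBal_of _ _ _ _ _ (h u v) (h (u - 1) v) (h (u - 1) (v - 1)) (h u (v - 1))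
      ?_ ?_ ?_ ?_ ?_ j
    · intro hh; exact hW _ _ (of_decide_eq_true hh)
    · intro hh; exact hW _ _ (of_decide_eq_true hh)
    · intro hh; exact hW _ _ (of_decide_eq_true hh)
    · intro hh; exact hW _ _ (of_decide_eq_true hh)
    · intro hh; exact hB _ _ (of_decide_eq_true hh))
  have hbal' : ∀ u v j, NodeBal (lab u v) (f' (Sum.inl (u, v))) (f' (Sum.inr (u - 1, v)))
      (f' (Sum.inl (u, v - 1))) (f' (Sum.inr (u, v))) j := by
    intro u v j
    have := DFunLike.congr_fun hbal (u, v, j)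
    rw [mhd, mtl] at this
    exact this
  -- a bound for the support
  obtain ⟨M, hM⟩ : ∃ M : ℤ, N ≤ M ∧ 0 ≤ M ∧ ∀ e ∈ f'.support, ∀ u v : ℤ,
      (e = Sum.inl (u, v) ∨ e = Sum.inr (u, v)) → -M < u ∧ u < M ∧ -M < v ∧ v < M := by
    let c : ((ℤ × ℤ) ⊕ (ℤ × ℤ)) → ℤ := Sum.elim (fun q => |q.1| + |q.2|) (fun q => |q.1| + |q.2|)
    have hc0 : ∀ e, 0 ≤ c e := by
      rintro (q | q) <;> simp only [c, Sum.elim_inl, Sum.elim_inr] <;> positivity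
    refine ⟨|N| + 1 + ∑ e ∈ f'.support, c e, ?_, ?_, ?_⟩
    · have := Finset.sum_nonneg (s := f'.support) (fun e _ => hc0 e)
      have := le_abs_self N
      omega
    · have := Finset.sum_nonneg (s := f'.support) (fun e _ => hc0 e)
      have := abs_nonneg N
      omega
    · intro e he u v huv
      have h1 := Finset.single_le_sum (f := c) (fun e _ => hc0 e) he
      have h2 : c e = |u| + |v| := by
        rcases huv with rfl | rfl <;> rfl
      have h3 := abs_nonneg N
      rw [h2] at h1
      have := neg_abs_le u
      have := le_abs_self u
      have := neg_abs_le v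
      have := le_abs_self v
      have := abs_nonneg u
      have := abs_nonneg v
      omega
  obtain ⟨hNM, hM0, hM⟩ := hM
  obtain ⟨k, k1, k2, k3⟩ := primitive (fun u v => f' (Sum.inl (u, v)))
    (fun u v => f' (Sum.inr (u, v))) M hM0
    (fun u v hne => hM _ (Finsupp.mem_support_iff.mpr hne) u v (Or.inl rfl))
    (fun u v hne => hM _ (Finsupp.mem_support_iff.mpr hne) u v (Or.inr rfl))
    (fun u v => total_of_nodeBal _ _ _ _ _ (hbal' u v))
  have hk : ∀ u v, NodeBal (lab u v) (k u v - k (u - 1) v) (k (u - 1) v - k (u - 1) (v - 1))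
      (k u (v - 1) - k (u - 1) (v - 1)) (k u v - k u (v - 1)) |> fun P => ∀ j, P j := by
    intro u v j
    rw [k1, k1, k2, k2]
    exact hbal' u v j
  refine ⟨k, M, ?_, k3, ?_, ?_⟩
  · intro u v
    have := tele (fun u => (k u v : ZMod p) - h u v) (-M) (by
      intro u
      have e1 := congrArg (Int.cast : ℤ → ZMod p) (k1 u v)
      rw [hf', hf1] at e1
      push_cast at e1
      linear_combination e1) (by
      intro u hu
      have : k u v = 0 := by
        by_contra hne
        have := k3 u v hne
        omega
      rw [this, h0 u v (by omega)]; simp) u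
    exact sub_eq_zero.mp this
  · intro u v hb
    exact (of_nodeBal _ _ _ _ _ _ _ _ _ (hk u v)).1 (decide_eq_true hb)
  · intro u v hb a b a' b' ha hb1 ha' hb1' hw hw'
    obtain ⟨e1, e2, e3, e4, e5, e6⟩ :=
      (of_nodeBal _ _ _ _ _ _ _ _ _ (hk u v)).2 (decide_eq_false hb)
    simp only [decide_eq_true_eq] at e1 e2 e3 e4 e5 e6
    rcases ha with rfl | rfl <;> rcases hb1 with rfl | rfl <;> rcases ha' with rfl | rfl <;>
      rcases hb1' with rfl | rfl <;> first | rfl | grind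

/-- Extension by zero of a vector on the white cells. -/
def extW {S : Finset Cell} {w : ℕ} {R : Type*} [CommRing R] (ω : Fin w ≃ whiteCells S)
    (x : Fin w → R) (c : Cell) : R := ∑ j, if (ω j : Cell) = c then x j else 0

lemma extW_apply {S : Finset Cell} {w : ℕ} {R : Type*} [CommRing R] (ω : Fin w ≃ whiteCells S)
    (x : Fin w → R) (j : Fin w) : extW ω x (ω j : Cell) = x j := by
  unfold extW
  rw [Finset.sum_eq_single j]
  · simp
  · intro i _ hi
    rw [if_neg]
    intro h
    exact hi (ω.injective (Subtype.ext h))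
  · simp

lemma extW_zero {S : Finset Cell} {w : ℕ} {R : Type*} [CommRing R] (ω : Fin w ≃ whiteCells S)
    (x : Fin w → R) (c : Cell) (hc : c ∉ S) : extW ω x c = 0 := by
  unfold extW
  refine Finset.sum_eq_zero fun j _ => if_neg ?_
  rintro rfl
  exact hc (Finset.mem_filter.mp (ω j).2).1

lemma adj_ite {R : Type*} [CommRing R] (c d : Cell) (r : R) :
    ((if Adjacent c d then 1 else 0 : ℤ) : R) * r =
      (if d = (c.1 + 1, c.2) then r else 0) + (if d = (c.1 - 1, c.2) then r else 0) +
      (if d = (c.1, c.2 + 1) then r else 0) + (if d = (c.1, c.2 - 1) then r else 0) := by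
  obtain ⟨c1, c2⟩ := c
  obtain ⟨d1, d2⟩ := d
  simp only [Adjacent, Prod.mk_sub_mk, Prod.mk.injEq]
  by_cases h1 : d1 = c1 + 1 ∧ d2 = c2
  · obtain ⟨rfl, rfl⟩ := h1
    rw [if_pos (by omega), if_pos (by omega), if_neg (by omega), if_neg (by omega),
      if_neg (by omega)]
    simp
  by_cases h2 : d1 = c1 - 1 ∧ d2 = c2
  · obtain ⟨rfl, rfl⟩ := h2
    rw [if_pos (by omega), if_neg (by omega), if_pos (by omega), if_neg (by omega),
      if_neg (by omega)]
    simp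
  by_cases h3 : d1 = c1 ∧ d2 = c2 + 1
  · obtain ⟨rfl, rfl⟩ := h3
    rw [if_pos (by omega), if_neg (by omega), if_neg (by omega), if_pos (by omega),
      if_neg (by omega)]
    simp
  by_cases h4 : d1 = c1 ∧ d2 = c2 - 1
  · obtain ⟨rfl, rfl⟩ := h4
    rw [if_pos (by omega), if_neg (by omega), if_neg (by omega), if_neg (by omega),
      if_pos (by omega)]
    simp
  rw [if_neg (by omega), if_neg h1, if_neg h2, if_neg h3, if_neg h4]
  simp

lemma mulVec_eq {S : Finset Cell} {b w : ℕ} {R : Type*} [CommRing R]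
    (β : Fin b ≃ blackCells S) (ω : Fin w ≃ whiteCells S) (x : Fin w → R) (i : Fin b) :
    ((btwMatrix β ω).map (Int.cast : ℤ → R)).mulVec x i =
      extW ω x ((β i : Cell).1 + 1, (β i : Cell).2) + extW ω x ((β i : Cell).1 - 1, (β i : Cell).2) +
      extW ω x ((β i : Cell).1, (β i : Cell).2 + 1) +
      extW ω x ((β i : Cell).1, (β i : Cell).2 - 1) := by
  simp only [Matrix.mulVec, dotProduct, Matrix.map_apply, btwMatrix, extW]
  rw [← Finset.sum_add_distrib, ← Finset.sum_add_distrib, ← Finset.sum_add_distrib]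
  exact Finset.sum_congr rfl fun j _ => adj_ite _ _ _

/-- The sign used to turn sums into differences. -/
def sgn (u v : ℤ) : ℤ := if Even (u + v) then 1 else -1

lemma sgn_u (u v : ℤ) : sgn (u - 1) v = - sgn u v := by
  unfold sgn
  by_cases h : Even (u + v)
  · rw [if_pos h, if_neg (by rw [Int.even_iff] at *; omega)]
  · rw [if_neg h, if_pos (by rw [Int.even_iff] at *; omega)]; simp

lemma sgn_v (u v : ℤ) : sgn u (v - 1) = - sgn u v := by
  unfold sgn
  by_cases h : Even (u + v)
  · rw [if_pos h, if_neg (by rw [Int.even_iff] at *; omega)]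
  · rw [if_neg h, if_pos (by rw [Int.even_iff] at *; omega)]; simp

lemma sgn_sq (u v : ℤ) : sgn u v * sgn u v = 1 := by
  unfold sgn; split_ifs <;> simp

lemma sgn_mixed {R : Type*} [CommRing R] (g : ℤ → ℤ → R) (u v : ℤ) :
    (sgn u v : R) * g u v - (sgn (u - 1) v : R) * g (u - 1) v - (sgn u (v - 1) : R) * g u (v - 1)
      + (sgn (u - 1) (v - 1) : R) * g (u - 1) (v - 1) =
    sgn u v * (g u v + g (u - 1) (v - 1) + g (u - 1) v + g u (v - 1)) := by
  rw [sgn_u u (v - 1), sgn_u u v, sgn_v u v]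
  push_cast
  ring

/-- No mass on missing white cells. -/
lemma no_mass {S : Finset Cell} (hS : IsBoard S) (k : ℤ → ℤ → ℤ) (M : ℤ)
    (hM : ∀ u v, k u v ≠ 0 → -M < u ∧ u < M ∧ -M < v ∧ v < M)
    (hk : ∀ u v, (u + v, u - v) ∉ S → ∀ a b a' b', (a = u ∨ a = u - 1) → (b = v ∨ b = v - 1) →
        (a' = u ∨ a' = u - 1) → (b' = v ∨ b' = v - 1) → (a + b + 1, a - b) ∉ S →
        (a' + b' + 1, a' - b') ∉ S → k a b = k a' b')
    (u v : ℤ) (huv : (u + v + 1, u - v) ∉ S) : k u v = 0 := by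
  classical
  let P : Cell → Prop := fun c => c ∉ S ∧ ((∃ u v, c = (u + v + 1, u - v) ∧ k u v ≠ 0) ∨
    (∃ u v, c = (u + v, u - v) ∧ ∃ a b, (a = u ∨ a = u - 1) ∧ (b = v ∨ b = v - 1) ∧
      (a + b + 1, a - b) ∉ S ∧ k a b ≠ 0))
  let box : Finset Cell := Finset.Icc (-(2 * M + 5)) (2 * M + 5) ×ˢ
    Finset.Icc (-(2 * M + 5)) (2 * M + 5)
  have hbox : ∀ c, P c → c ∈ box := by
    rintro c ⟨_, ⟨u, v, rfl, h⟩ | ⟨u, v, rfl, a, b, ha, hb, _, h⟩⟩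
    · have := hM _ _ h
      simp only [box, Finset.mem_product, Finset.mem_Icc]
      omega
    · have := hM _ _ h
      simp only [box, Finset.mem_product, Finset.mem_Icc]
      omega
  have hD : ∀ c, c ∈ box.filter P ↔ P c := fun c => by
    rw [Finset.mem_filter]; exact ⟨fun h => h.2, fun h => ⟨hbox c h, h⟩⟩
  have hemp := board_no_hole hS (box.filter P) (fun q hq => ((hD q).1 hq).1) (by
    intro q hq r hqr hr
    rw [hD] at hq ⊢
    refine ⟨hr, ?_⟩
    obtain ⟨hq0, ⟨u, v, rfl, h⟩ | ⟨u, v, rfl, a, b, ha, hb, hab, h⟩⟩ := hq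
    · right
      -- `q` is a white cell, `r` a black one
      obtain ⟨r1, r2⟩ := r
      have : ∃ u' v', (r1, r2) = (u' + v', u' - v') ∧ (u = u' ∨ u = u' - 1) ∧
          (v = v' ∨ v = v' - 1) := by
        simp only [Adjacent, Prod.mk_sub_mk, Prod.mk.injEq] at hqr ⊢
        rcases hqr with hh | hh | hh | hh
        · exact ⟨u, v, by omega⟩
        · exact ⟨u + 1, v + 1, by omega⟩
        · exact ⟨u, v + 1, by omega⟩
        · exact ⟨u + 1, v, by omega⟩
      obtain ⟨u', v', e, e1, e2⟩ := this
      exact ⟨u', v', e, u, v, e1, e2, hq0, h⟩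
    · left
      obtain ⟨r1, r2⟩ := r
      have : ∃ u' v', (r1, r2) = (u' + v' + 1, u' - v') ∧ (u' = u ∨ u' = u - 1) ∧
          (v' = v ∨ v' = v - 1) := by
        simp only [Adjacent, Prod.mk_sub_mk, Prod.mk.injEq] at hqr ⊢
        rcases hqr with hh | hh | hh | hh
        · exact ⟨u - 1, v - 1, by omega⟩
        · exact ⟨u, v, by omega⟩
        · exact ⟨u - 1, v, by omega⟩
        · exact ⟨u, v - 1, by omega⟩
      obtain ⟨u', v', e, e1, e2⟩ := this
      refine ⟨u', v', e, ?_⟩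
      rw [hk u v hq0 u' v' a b e1 e2 ha hb (e ▸ hr) hab]
      exact h)
  by_contra hne
  have : (u + v + 1, u - v) ∈ box.filter P := (hD _).2 ⟨huv, Or.inl ⟨u, v, rfl, hne⟩⟩
  rw [hemp] at this
  simp at this

lemma lift_board {S : Finset Cell} (hS : IsBoard S) {b w : ℕ}
    (β : Fin b ≃ blackCells S) (ω : Fin w ≃ whiteCells S) (p : ℕ) (hp : p ≠ 0)
    (x : Fin w → ZMod p) (hx : ((btwMatrix β ω).map (Int.cast : ℤ → ZMod p)).mulVec x = 0) :
    ∃ y : Fin w → ℤ, (btwMatrix β ω).mulVec y = 0 ∧ ∀ i, (y i : ZMod p) = x i := by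
  classical
  obtain ⟨N, hN⟩ : ∃ N : ℤ, ∀ c ∈ S, |c.1| + |c.2| + 1 < N := by
    refine ⟨(∑ c ∈ S, (|c.1| + |c.2|)) + 2, fun c hc => ?_⟩
    have := Finset.single_le_sum (f := fun c : Cell => |c.1| + |c.2|)
      (fun c _ => by positivity) hc
    omega
  obtain ⟨k, M, k1, k2, k3, k4⟩ := lift_core p hp (fun u v => (u + v, u - v) ∈ S)
    (fun u v => (u + v + 1, u - v) ∈ S)
    (fun u v => (sgn u v : ZMod p) * extW ω x (u + v + 1, u - v)) N (by
      intro u v hne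
      by_cases hc : (u + v + 1, u - v) ∈ S
      · have := hN _ hc
        simp only at this
        have h1 := neg_abs_le (u + v + 1)
        have h2 := le_abs_self (u + v + 1)
        have h3 := neg_abs_le (u - v)
        have h4 := le_abs_self (u - v)
        omega
      · exact absurd (by rw [extW_zero ω x _ hc, mul_zero]) hne)
    (by
      intro u v hc
      rw [extW_zero ω x _ hc, mul_zero])
    (by
      intro u v hc
      have hb : (u + v, u - v) ∈ blackCells S :=
        Finset.mem_filter.mpr ⟨hc, by show Even (u + v + (u - v)); exact ⟨u, by ring⟩⟩
      have := congrFun hx (β.symm ⟨_, hb⟩)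
      rw [mulVec_eq] at this
      simp only [Equiv.apply_symm_apply, Pi.zero_apply] at this
      rw [sgn_mixed (fun u v => extW ω x (u + v + 1, u - v)) u v]
      rw [← mul_zero (sgn u v : ZMod p), ← this]
      congr 1
      ring_nf)
  have k5 := no_mass hS k M k2 k4
  let y : Fin w → ℤ := fun j =>
    (fun u v => sgn u v * k u v) (((ω j : Cell).1 + (ω j : Cell).2 - 1) / 2)
      (((ω j : Cell).1 - (ω j : Cell).2 - 1) / 2)
  have hodd : ∀ j, ∃ u v, (ω j : Cell) = (u + v + 1, u - v) ∧ y j = sgn u v * k u v := by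
    intro j
    have hj : ¬ Even ((ω j : Cell).1 + (ω j : Cell).2) := (Finset.mem_filter.mp (ω j).2).2
    rw [Int.even_iff] at hj
    refine ⟨((ω j : Cell).1 + (ω j : Cell).2 - 1) / 2, ((ω j : Cell).1 - (ω j : Cell).2 - 1) / 2,
      ?_, rfl⟩
    ext
    · simp only; omega
    · simp only; omega
  have hy : ∀ u v, extW ω y (u + v + 1, u - v) = sgn u v * k u v := by
    intro u v
    by_cases hc : (u + v + 1, u - v) ∈ S
    · have hw : (u + v + 1, u - v) ∈ whiteCells S :=
        Finset.mem_filter.mpr ⟨hc, by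
          show ¬ Even (u + v + 1 + (u - v)); rw [Int.even_iff]; omega⟩
      obtain ⟨j, hj⟩ := ω.surjective ⟨_, hw⟩
      obtain ⟨u', v', e1, e2⟩ := hodd j
      have e3 := extW_apply ω y j
      rw [hj] at e1 e3
      simp only [Prod.mk.injEq] at e1
      obtain rfl : u = u' := by omega
      obtain rfl : v = v' := by omega
      rw [← e2]
      exact e3
    · rw [extW_zero ω y _ hc, k5 u v hc, mul_zero]
  refine ⟨y, ?_, ?_⟩
  · ext i
    have e := mulVec_eq (R := ℤ) β ω y i
    have hid : (btwMatrix β ω).map (Int.cast : ℤ → ℤ) = btwMatrix β ω := by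
      ext a c; simp
    rw [hid] at e
    rw [e, Pi.zero_apply]
    obtain ⟨hc, hev⟩ := Finset.mem_filter.mp (β i).2
    generalize (β i : Cell) = c at hc hev ⊢
    obtain ⟨c1, c2⟩ := c
    obtain ⟨u, hu⟩ : Even (c1 + c2) := hev
    obtain ⟨v, rfl, rfl⟩ : ∃ v, c1 = u + v ∧ c2 = u - v := ⟨c1 - u, by omega, by omega⟩
    have e3 := k3 u v hc
    have f1 := hy u v
    have f2 := hy (u - 1) v
    have f3 := hy u (v - 1)
    have f4 := hy (u - 1) (v - 1)
    rw [sgn_u] at f2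
    rw [sgn_v] at f3
    rw [sgn_u, sgn_v] at f4
    have g2 : (u - 1 + v + 1, u - 1 - v) = (u + v, u - v - 1) := by ext <;> simp <;> ring
    have g3 : (u + (v - 1) + 1, u - (v - 1)) = (u + v, u - v + 1) := by ext <;> simp <;> ring
    have g4 : (u - 1 + (v - 1) + 1, u - 1 - (v - 1)) = (u + v - 1, u - v) := by
      ext <;> simp <;> ring
    rw [g2] at f2
    rw [g3] at f3
    rw [g4] at f4
    simp only
    rw [f1, f2, f3, f4]
    linear_combination sgn u v * e3
  · intro j
    obtain ⟨u, v, e1, e2⟩ := hodd j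
    rw [e2]
    push_cast
    rw [k1, ← e1, extW_apply, ← mul_assoc, ← Int.cast_mul, sgn_sq, Int.cast_one, one_mul]

/-- **Corollary.** The rank of the black-to-white matrix of a board over `ℚ`
equals its rank over `ℤ/pℤ`, for every prime `p`. -/
theorem btwMatrix_rank_rat_eq_rank_zmod
    (S : Finset Cell) (hS : IsBoard S) (b w : ℕ)
    (β : Fin b ≃ blackCells S) (ω : Fin w ≃ whiteCells S)
    (p : ℕ) (hp : p.Prime) :
    ((btwMatrix β ω).map (Int.cast : ℤ → ℚ)).rank =
      ((btwMatrix β ω).map (Int.cast : ℤ → ZMod p)).rank := by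
  haveI := Fact.mk hp
  exact rank_eq_of_lift _ p fun x hx => lift_board hS β ω p hp.ne_zero x hx
end

section
/- Let A be an n × m integer matrix admitting a factorization A = L · D̃ · U, where L is an n × n integer matrix with determinant 1 or −1, U is an m × m integer matrix with determinant 1 or −1, and D̃ is an n × m defective identity matrix. Then for every v : Fin n → ℤ, if the system A · x = v admits a solution x with rational entries, it admits a solution x with integer entries. -/
/-- A defective identity matrix: obtained from an identity matrix by inserting
rows and columns of zeros. -/
def IsDefectiveIdentity {n m : ℕ} (D : Matrix (Fin n) (Fin m) ℤ) : Prop :=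
  ∃ (k : ℕ) (f : Fin k → Fin n) (g : Fin k → Fin m),
    StrictMono f ∧ StrictMono g ∧
    (∀ t, D (f t) (g t) = 1) ∧
    (∀ i j, (∀ t, ¬ (f t = i ∧ g t = j)) → D i j = 0)

lemma selection_transpose_mul {k n : ℕ} (f : Fin k → Fin n) (hf : Function.Injective f) :
    (Matrix.of fun i t => if f t = i then (1 : ℤ) else 0).transpose *
      (Matrix.of fun i t => if f t = i then (1 : ℤ) else 0) = 1 := by
  ext s t
  simp [Matrix.mul_apply, Matrix.one_apply, hf.eq_iff, eq_comm]

lemma IsDefectiveIdentity.mul_transpose_mul {n m : ℕ} {D : Matrix (Fin n) (Fin m) ℤ}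
    (hD : IsDefectiveIdentity D) : D * D.transpose * D = D := by
  obtain ⟨k, f, g, hf, hg, h1, h0⟩ := hD
  have hP := selection_transpose_mul f hf.injective
  have hQ := selection_transpose_mul g hg.injective
  have hDPQ : D = (Matrix.of fun i t => if f t = i then (1 : ℤ) else 0) *
      (Matrix.of fun i t => if g t = i then (1 : ℤ) else 0).transpose := by
    ext i j
    simp only [Matrix.mul_apply, Matrix.of_apply, Matrix.transpose_apply]
    by_cases h : ∃ t, f t = i ∧ g t = j
    · obtain ⟨t, rfl, rfl⟩ := h
      rw [h1]
      simp [hf.injective.eq_iff, hg.injective.eq_iff]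
    · push Not at h
      rw [h0 i j (fun t ht => h t ht.1 ht.2)]
      symm
      apply Finset.sum_eq_zero
      intro t _
      by_cases hi : f t = i
      · simp [h t hi]
      · simp [hi]
  generalize (Matrix.of fun i t => if f t = i then (1 : ℤ) else 0) = P at *
  generalize (Matrix.of fun i t => if g t = i then (1 : ℤ) else 0) = Q at *
  subst hDPQ
  calc P * Q.transpose * (P * Q.transpose).transpose * (P * Q.transpose)
      = P * (Q.transpose * Q) * (P.transpose * P) * Q.transpose := by
        simp only [Matrix.transpose_mul, Matrix.transpose_transpose, Matrix.mul_assoc]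
    _ = P * Q.transpose := by rw [hP, hQ]; simp

/-- **Lemma.** If an integer matrix `A` factors as `L · D̃ · U` with
`det L, det U = ±1` and `D̃` a defective identity, then rational solvability of
`A x = v` (for integral `v`) implies integral solvability. -/
theorem int_solution_of_rat_solution_of_LDU
    (n m : ℕ) (A : Matrix (Fin n) (Fin m) ℤ)
    (L : Matrix (Fin n) (Fin n) ℤ) (D : Matrix (Fin n) (Fin m) ℤ)
    (U : Matrix (Fin m) (Fin m) ℤ)
    (hL : L.det = 1 ∨ L.det = -1) (hU : U.det = 1 ∨ U.det = -1)
    (hD : IsDefectiveIdentity D) (hA : A = L * D * U) (v : Fin n → ℤ)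
    (hrat : ∃ x : Fin m → ℚ,
      (A.map (Int.cast : ℤ → ℚ)).mulVec x = fun i => (v i : ℚ)) :
    ∃ x : Fin m → ℤ, A.mulVec x = v := by
  have hLu : IsUnit L.det := by rcases hL with h | h <;> simp [h]
  have hUu : IsUnit U.det := by rcases hU with h | h <;> simp [h]
  have hDD := hD.mul_transpose_mul
  have hAGA : A * (U⁻¹ * D.transpose * L⁻¹) * A = A := by
    calc A * (U⁻¹ * D.transpose * L⁻¹) * A
        = L * D * (U * U⁻¹) * D.transpose * (L⁻¹ * L) * D * U := by
          rw [hA]; simp only [Matrix.mul_assoc]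
      _ = L * (D * D.transpose * D) * U := by
          rw [Matrix.mul_nonsing_inv _ hUu, Matrix.nonsing_inv_mul _ hLu]
          simp only [Matrix.mul_assoc, Matrix.mul_one, Matrix.one_mul]
      _ = A := by rw [hDD, hA]
  generalize U⁻¹ * D.transpose * L⁻¹ = G at hAGA
  obtain ⟨x, hx⟩ := hrat
  have hq : (A * G).map (Int.cast : ℤ → ℚ) * A.map (Int.cast : ℤ → ℚ)
      = A.map (Int.cast : ℤ → ℚ) := by
    have h := congrArg (fun M => M.map (Int.castRingHom ℚ)) hAGA
    simp only [Matrix.map_mul (f := Int.castRingHom ℚ) (L := A * G)] at h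
    exact h
  refine ⟨G.mulVec v, ?_⟩
  rw [Matrix.mulVec_mulVec]
  have hv : ((A * G).map (Int.cast : ℤ → ℚ)).mulVec (fun i => (v i : ℚ))
      = fun i => (v i : ℚ) := by
    rw [← hx, Matrix.mulVec_mulVec, hq]
  funext i
  have hi := congrFun hv i
  simp only [Matrix.mulVec, dotProduct, Matrix.map_apply] at hi ⊢
  exact_mod_cast hi
end
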